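/- arXiv:2204.07798 — 3 statements merged into one kernel-verified Lean document; each statement's English description precedes it below -/
import Mathlib

section
/- Let p, q, r ≥ 0 be integers with at most one of them equal to 0. Then the Laplacian permanental polynomial of θ(p,q,r) evaluated at x = 2 satisfies per(2I − L(θ(p,q,r))) = 7/2 + (1/2)(−1)^{p+r} + (1/2)(−1)^{p+q} + (1/2)(−1)^{r+q} + (−1)^q + (−1)^r + (−1)^p + 2(−1)^{p+q+r}. -/
open scoped Classical
open Polynomial

noncomputable section

/-- The Laplacian permanental polynomial of `G` evaluated at `x = 2`:
`per(2·I − L(G))`. -/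
def lapPermAtTwo {V : Type*} [Fintype V] (G : SimpleGraph V) : ℚ :=
  Matrix.permanent (Matrix.diagonal (fun _ : V => (2 : ℚ)) - G.lapMatrix ℚ)

/-- The bicyclic graph `θ(p,q,r)` on `p + q + r + 2` vertices: the two hub vertices `0`
and `1` are joined by three internally disjoint paths having `p`, `q` and `r` internal
vertices respectively (internal vertices `2, …, p+1`, then `p+2, …, p+q+1`, then
`p+q+2, …, p+q+r+1`); a path with `0` internal vertices is the edge `{0, 1}`. -/
def thetaGraph (p q r : ℕ) : SimpleGraph (Fin (p + q + r + 2)) :=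
  SimpleGraph.fromRel (fun i j =>
    (p = 0 ∧ i.val = 0 ∧ j.val = 1) ∨
    (0 < p ∧ i.val = 0 ∧ j.val = 2) ∨
    (2 ≤ i.val ∧ i.val + 1 = j.val ∧ j.val < p + 2) ∨
    (0 < p ∧ i.val = p + 1 ∧ j.val = 1) ∨
    (q = 0 ∧ i.val = 0 ∧ j.val = 1) ∨
    (0 < q ∧ i.val = 0 ∧ j.val = p + 2) ∨
    (p + 2 ≤ i.val ∧ i.val + 1 = j.val ∧ j.val < p + q + 2) ∨
    (0 < q ∧ i.val = p + q + 1 ∧ j.val = 1) ∨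
    (r = 0 ∧ i.val = 0 ∧ j.val = 1) ∨
    (0 < r ∧ i.val = 0 ∧ j.val = p + q + 2) ∨
    (p + q + 2 ≤ i.val ∧ i.val + 1 = j.val) ∨
    (0 < r ∧ i.val = p + q + r + 1 ∧ j.val = 1))


section helpers
open Matrix

/-- Adding a path with `p` internal vertices between `a` and `b`. -/
def addPath {α : Type} [DecidableEq α] (N : Matrix α α ℤ) (a b : α) (p : ℕ) :
    Matrix (α ⊕ Fin p) (α ⊕ Fin p) ℤ
  | Sum.inl x, Sum.inl y =>
      N x y + if p = 0 ∧ ((x = a ∧ y = b) ∨ (x = b ∧ y = a)) then 1 else 0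
  | Sum.inl x, Sum.inr i =>
      (if x = a ∧ i.val = 0 then 1 else 0) + (if x = b ∧ i.val + 1 = p then 1 else 0)
  | Sum.inr i, Sum.inl x =>
      (if x = a ∧ i.val = 0 then 1 else 0) + (if x = b ∧ i.val + 1 = p then 1 else 0)
  | Sum.inr i, Sum.inr j => if i.val + 1 = j.val ∨ j.val + 1 = i.val then 1 else 0

/-- The theta matrix. -/
def thetaMat (p q r : ℕ) : Matrix (((Fin 2 ⊕ Fin p) ⊕ Fin q) ⊕ Fin r)
    (((Fin 2 ⊕ Fin p) ⊕ Fin q) ⊕ Fin r) ℤ :=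
  addPath (addPath (addPath (Matrix.diagonal fun _ => -1) 0 1 p) (Sum.inl 0) (Sum.inl 1) q)
    (Sum.inl (Sum.inl 0)) (Sum.inl (Sum.inl 1)) r

set_option maxRecDepth 100000 in
theorem base000 : (thetaMat 0 0 0).permanent = 10 := by decide +kernel
set_option maxRecDepth 100000 in
theorem base001 : (thetaMat 0 0 1).permanent = 2 := by decide +kernel
set_option maxRecDepth 100000 in
theorem base011 : (thetaMat 0 1 1).permanent = 4 := by decide +kernel
set_option maxRecDepth 100000 in
theorem base111 : (thetaMat 1 1 1).permanent = 0 := by decide +kernel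

/-- Replace row `a` of `M` by `v`. -/
def rep {α : Type} [DecidableEq α] (M : Matrix α α ℤ) (a : α) (v : α → ℤ) : Matrix α α ℤ :=
  Matrix.of fun x y => if x = a then v y else M x y

theorem rep_apply {α : Type} [DecidableEq α] (M : Matrix α α ℤ) (a : α) (v : α → ℤ) (x y : α) :
    rep M a v x y = if x = a then v y else M x y := rfl

theorem perm_option {α : Type} [DecidableEq α] [Fintype α] (M : Matrix (Option α) (Option α) ℤ) :
    M.permanent = M none none * (M.submatrix some some).permanent +
      ∑ a, M (some a) none * Matrix.permanent
        (rep (M.submatrix some some) a (fun y => M none (some y))) := by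
  unfold Matrix.permanent
  rw [← Equiv.Perm.decomposeOption.symm.sum_comp, Fintype.sum_prod_type, Fintype.sum_option]
  congr 1
  · simp [Fintype.prod_option, Finset.mul_sum]
  · refine Finset.sum_congr rfl fun a _ => ?_
    rw [Finset.mul_sum]
    refine Finset.sum_congr rfl fun σ _ => ?_
    simp only [Equiv.Perm.decomposeOption_symm_apply, Fintype.prod_option]
    congr 1
    · simp
      refine Finset.prod_congr rfl fun x _ => ?_
      by_cases h : σ x = a
      · simp [h, rep_apply]
      · simp [rep_apply, Equiv.swap_apply_of_ne_of_ne, h]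

theorem perm_rep_add {α : Type} [DecidableEq α] [Fintype α] (M : Matrix α α ℤ) (a : α)
    (u v : α → ℤ) : (rep M a (fun y => u y + v y)).permanent =
      (rep M a u).permanent + (rep M a v).permanent := by
  unfold Matrix.permanent
  rw [← Finset.sum_add_distrib]
  refine Finset.sum_congr rfl fun σ _ => ?_
  have key : ∀ w : α → ℤ, ∏ i, rep M a w (σ i) i =
      w (σ.symm a) * ∏ i ∈ Finset.univ.erase (σ.symm a), M (σ i) i := by
    intro w
    rw [← Finset.mul_prod_erase _ _ (Finset.mem_univ (σ.symm a))]
    congr 1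
    · simp [rep_apply]
    · refine Finset.prod_congr rfl fun i hi => ?_
      rw [rep_apply, if_neg]
      rintro rfl
      simp at hi
  rw [key, key, key, add_mul]

theorem rep_comm {α : Type} [DecidableEq α] (M : Matrix α α ℤ) (a b : α) (hab : a ≠ b)
    (u v : α → ℤ) : rep (rep M a u) b v = rep (rep M b v) a u := by
  ext x y
  simp only [rep_apply]
  split_ifs with h1 h2
  · exact absurd (h2.symm.trans h1) hab
  all_goals rfl

theorem rep_self {α : Type} [DecidableEq α] (M : Matrix α α ℤ) (a : α) :
    rep M a (fun y => M a y) = M := by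
  ext x y
  simp only [rep_apply]
  split_ifs with h1
  · rw [h1]
  · rfl

theorem perm_rep_add_self {α : Type} [DecidableEq α] [Fintype α] (M : Matrix α α ℤ) (a : α)
    (w v : α → ℤ) (hw : ∀ y, w y = M a y + v y) :
    (rep M a w).permanent = M.permanent + (rep M a v).permanent := by
  obtain rfl : w = fun y => M a y + v y := funext hw
  rw [perm_rep_add (u := fun y => M a y)]
  congr 2
  exact rep_self M a

/-- Indicator vector. -/
def ind {α : Type} [DecidableEq α] (c : α) : α → ℤ := fun y => if y = c then 1 else 0

theorem perm_subdivide {α : Type} [DecidableEq α] [Fintype α] (N : Matrix α α ℤ) (a b : α)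
    (hab : a ≠ b) (M : Matrix (Option (Option α)) (Option (Option α)) ℤ)
    (h11 : M none none = 0) (h12 : M none (some none) = 1) (h21 : M (some none) none = 1)
    (h22 : M (some none) (some none) = 0)
    (h1 : ∀ x, M none (some (some x)) = if x = a then 1 else 0)
    (h1' : ∀ x, M (some (some x)) none = if x = a then 1 else 0)
    (h2 : ∀ x, M (some none) (some (some x)) = if x = b then 1 else 0)
    (h2' : ∀ x, M (some (some x)) (some none) = if x = b then 1 else 0)
    (h : ∀ x y, M (some (some x)) (some (some y)) = N x y) :
    M.permanent = Matrix.permanent (Matrix.of fun x y =>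
      N x y + if (x = a ∧ y = b) ∨ (x = b ∧ y = a) then 1 else 0) := by
  have L : M.permanent = N.permanent + (rep N b (ind a)).permanent
      + (rep N a (ind b)).permanent
      + (rep (rep N a (ind a)) b (ind b)).permanent := by
    rw [perm_option, h11, zero_mul, zero_add, Fintype.sum_option, h21, one_mul]
    simp only [h1', ite_mul, one_mul, zero_mul, Finset.sum_ite_eq', Finset.mem_univ, if_true]
    rw [perm_option, perm_option, Finset.sum_eq_single b, Finset.sum_eq_add a b hab]
    · have e1 : ∀ (v : Option α → ℤ), (rep (M.submatrix some some) none v).submatrix some some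
          = N := by
        intro v; ext x y; simp [rep_apply, h]
      have e2 : ∀ (v : Option α → ℤ), (rep (M.submatrix some some) (some a) v).submatrix some some
          = rep N a (fun y => v (some y)) := by
        intro v; ext x y
        simp [rep_apply, h]
      have e3 : rep (rep N a (ind a)) a (ind b) = rep N a (ind b) := by
        ext x y; simp only [rep_apply]; split_ifs <;> rfl
      rw [e1, e2]
      simp only [rep_apply, submatrix_apply, h1, h2, h2', h12, h22]
      simp only [hab.symm, if_true, if_false, reduceCtorEq, Option.some.injEq]
      change 1 * N.permanent + 1 * (rep N b (ind a)).permanent + (0 * (rep N a (ind a)).permanent +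
        (1 * (rep (rep N a (ind a)) a (ind b)).permanent + 1 *
          (rep (rep N a (ind a)) b (ind b)).permanent)) = _
      rw [e3]
      ring
    · intro c _ hc
      simp [rep_apply, h2', hc.1, hc.2]
    · simp
    · simp
    · intro c _ hc
      simp [rep_apply, h2', hc]
    · simp
  have R : (Matrix.of fun x y =>
      N x y + if (x = a ∧ y = b) ∨ (x = b ∧ y = a) then 1 else 0) =
      rep (rep N a (fun y => N a y + ind b y)) b (fun y => N b y + ind a y) := by
    ext x y
    simp only [rep_apply, of_apply, ind]
    by_cases hb : x = b
    · subst hb; simp [hab.symm]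
    · by_cases ha : x = a
      · subst ha; simp [hab]
      · simp [ha, hb]
  have S : (rep (rep N a (ind b)) b (ind a)).permanent =
      (rep (rep N a (ind a)) b (ind b)).permanent := by
    rw [← Matrix.permanent_permute_cols (Equiv.swap a b)]
    congr 1
    ext x y
    by_cases hb : x = b
    · subst hb; simp [rep_apply, hab]
    · by_cases ha : x = a
      · subst ha
        simp [rep_apply, hab]
      · simp [rep_apply, ha, hb, Equiv.swap_apply_of_ne_of_ne ha hb]
  have T1 := perm_rep_add_self (rep N a (fun y => N a y + ind b y)) b
    (fun y => N b y + ind a y) (ind a) (by intro y; simp [rep_apply, hab.symm])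
  have T2 := perm_rep_add_self N a (fun y => N a y + ind b y) (ind b) (fun _ => rfl)
  have T3 := perm_rep_add_self (rep N b (ind a)) a
    (fun y => N a y + ind b y) (ind b) (by intro y; simp [rep_apply, hab])
  rw [rep_comm _ _ _ hab.symm, rep_comm _ _ _ hab.symm] at T3
  rw [L, R, T1, T2, T3, S]
  ring

theorem perm_equiv {α β : Type} [DecidableEq α] [Fintype α] [DecidableEq β] [Fintype β]
    {R : Type} [CommRing R] (e : α ≃ β) (M : Matrix β β R) :
    (M.submatrix e e).permanent = M.permanent := by
  unfold Matrix.permanent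
  refine Fintype.sum_equiv (Equiv.permCongr e) _ _ fun σ => ?_
  refine Fintype.prod_equiv e _ _ fun i => ?_
  simp

/-- The equivalence peeling off the last two path vertices. -/
def peel (α : Type) (p : ℕ) : Option (Option (α ⊕ Fin p)) ≃ α ⊕ Fin (p + 2) where
  toFun
    | none => Sum.inr ⟨p + 1, by omega⟩
    | some none => Sum.inr ⟨p, by omega⟩
    | some (some (Sum.inl x)) => Sum.inl x
    | some (some (Sum.inr i)) => Sum.inr ⟨i.val, by omega⟩
  invFun
    | Sum.inl x => some (some (Sum.inl x))
    | Sum.inr i => if h : i.val < p then some (some (Sum.inr ⟨i.val, h⟩)) else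
        if i.val = p then some none else none
  left_inv := by
    rintro (_ | _ | x | i) <;> simp
  right_inv := by
    rintro (x | i)
    · rfl
    · dsimp only
      split_ifs with h1 h2
      · rfl
      · simp [Fin.ext_iff, h2]
      · simp [Fin.ext_iff]; omega

/-- The last vertex of the path before `b`. -/
def lastV {α : Type} (a : α) (p : ℕ) : α ⊕ Fin p :=
  if h : p = 0 then Sum.inl a else Sum.inr ⟨p - 1, by omega⟩

theorem perm_addPath_two {α : Type} [DecidableEq α] [Fintype α] (N : Matrix α α ℤ) (a b : α)
    (hab : a ≠ b) (p : ℕ) :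
    (addPath N a b (p + 2)).permanent = (addPath N a b p).permanent := by
  rw [← perm_equiv (peel α p)]
  rw [perm_subdivide (Matrix.of fun x y => addPath N a b p x y -
    if (x = Sum.inl b ∧ y = lastV a p) ∨ (x = lastV a p ∧ y = Sum.inl b) then 1 else 0)
    (Sum.inl b) (lastV a p)]
  · congr 1
    ext x y
    simp
  · unfold lastV
    split_ifs
    · simpa using hab.symm
    · simp
  · simp [peel, addPath]
  · simp [peel, addPath]
  · simp [peel, addPath]
  · simp [peel, addPath]
  · rintro (x | i) <;> simp [peel, addPath] <;> omega
  · rintro (x | i) <;> simp [peel, addPath] <;> omega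
  · by_cases hp : p = 0
    · subst hp
      rintro (x | i)
      · simp [peel, addPath, lastV]
      · exact i.elim0
    · rintro (x | i)
      · simp [peel, addPath, lastV, hp]
      · have h2 : i.val + 1 = p ↔ i.val = p - 1 := by omega
        have h3 : ¬ (p + 1 = i.val) := by omega
        simp [peel, addPath, lastV, hp, Fin.ext_iff, h2, h3]
  · by_cases hp : p = 0
    · subst hp
      rintro (x | i)
      · simp [peel, addPath, lastV]
      · exact i.elim0
    · rintro (x | i)
      · simp [peel, addPath, lastV, hp]
      · have h2 : i.val + 1 = p ↔ i.val = p - 1 := by omega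
        have h3 : ¬ (p + 1 = i.val) := by omega
        simp [peel, addPath, lastV, hp, Fin.ext_iff, h2, h3]
  · rintro (x | i) (y | j)
    · by_cases hp : p = 0
      · subst hp
        simp [peel, addPath, lastV, or_comm]
      · simp [peel, addPath, lastV, hp]
    · have hp : p ≠ 0 := by have := j.2; omega
      have : ¬ (j.val + 1 = p + 2) := by omega
      have h2 : j.val + 1 = p ↔ j.val = p - 1 := by omega
      simp [peel, addPath, lastV, hp, Fin.ext_iff, this, h2]
      omega
    · have hp : p ≠ 0 := by have := i.2; omega
      have : ¬ (i.val + 1 = p + 2) := by omega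
      have h2 : i.val + 1 = p ↔ i.val = p - 1 := by omega
      simp [peel, addPath, lastV, hp, Fin.ext_iff, this, h2, and_comm]
      omega
    · simp [peel, addPath]

theorem perm_addPath_mod {α : Type} [DecidableEq α] [Fintype α] (N : Matrix α α ℤ) (a b : α)
    (hab : a ≠ b) (p : ℕ) :
    (addPath N a b p).permanent = (addPath N a b (p % 2)).permanent := by
  induction p using Nat.strong_induction_on with
  | _ p ih =>
    match p with
    | 0 => rfl
    | 1 => rfl
    | p + 2 => rw [perm_addPath_two _ _ _ hab, ih p (by omega), Nat.add_mod_right]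

/-- Exchange two summands. -/
def sumSwap (α β γ : Type) : (α ⊕ β) ⊕ γ ≃ (α ⊕ γ) ⊕ β where
  toFun
    | Sum.inl (Sum.inl x) => Sum.inl (Sum.inl x)
    | Sum.inl (Sum.inr x) => Sum.inr x
    | Sum.inr x => Sum.inl (Sum.inr x)
  invFun
    | Sum.inl (Sum.inl x) => Sum.inl (Sum.inl x)
    | Sum.inl (Sum.inr x) => Sum.inr x
    | Sum.inr x => Sum.inl (Sum.inr x)
  left_inv := by rintro ((x | x) | x) <;> rfl
  right_inv := by rintro ((x | x) | x) <;> rfl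

theorem addPath_swap {α : Type} [DecidableEq α] (N : Matrix α α ℤ) (a b : α) (p q : ℕ) :
    (addPath (addPath N a b q) (Sum.inl a) (Sum.inl b) p).submatrix
      (sumSwap α (Fin p) (Fin q)) (sumSwap α (Fin p) (Fin q)) =
      addPath (addPath N a b p) (Sum.inl a) (Sum.inl b) q := by
  ext ((x | x) | x) ((y | y) | y) <;> simp [sumSwap, addPath] <;> ring

theorem addPath_congr {α β : Type} [DecidableEq α] [DecidableEq β] (e : α ≃ β)
    (N : Matrix β β ℤ) (a b : α) (p : ℕ) :
    (addPath N (e a) (e b) p).submatrix (e.sumCongr (Equiv.refl (Fin p)))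
      (e.sumCongr (Equiv.refl (Fin p))) = addPath (N.submatrix e e) a b p := by
  ext (x | x) (y | y) <;> simp [addPath]

theorem theta_swap1 (p q r : ℕ) : (thetaMat p q r).permanent = (thetaMat p r q).permanent := by
  unfold thetaMat
  rw [← perm_equiv (sumSwap _ (Fin q) (Fin r))
    (addPath (addPath _ _ _ r) _ _ q), addPath_swap]

theorem theta_swap2 (p q r : ℕ) : (thetaMat p q r).permanent = (thetaMat q p r).permanent := by
  unfold thetaMat
  rw [← addPath_swap _ _ _ q p]
  have := addPath_congr (sumSwap (Fin 2) (Fin q) (Fin p))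
    (addPath (addPath (Matrix.diagonal fun _ => -1) 0 1 p) (Sum.inl 0) (Sum.inl 1) q)
    (Sum.inl (Sum.inl 0)) (Sum.inl (Sum.inl 1)) r
  rw [← this, perm_equiv]
  rfl

theorem theta_mod (p q r : ℕ) : (thetaMat p q r).permanent = (thetaMat p q (r % 2)).permanent := by
  unfold thetaMat
  exact perm_addPath_mod _ _ _ (by simp) _

theorem theta_mod_all (p q r : ℕ) :
    (thetaMat p q r).permanent = (thetaMat (p % 2) (q % 2) (r % 2)).permanent := by
  rw [theta_mod, theta_swap1, theta_mod, theta_swap1, theta_swap2, theta_swap1, theta_mod,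
    theta_swap1, theta_swap2]

theorem theta_value (p q r : ℕ) : (((thetaMat p q r).permanent : ℤ) : ℚ) =
      7/2 + (1/2) * (-1 : ℚ) ^ (p + r) + (1/2) * (-1 : ℚ) ^ (p + q)
        + (1/2) * (-1 : ℚ) ^ (r + q) + (-1 : ℚ) ^ q + (-1 : ℚ) ^ r + (-1 : ℚ) ^ p
        + 2 * (-1 : ℚ) ^ (p + q + r) := by
  have b010 : (thetaMat 0 1 0).permanent = 2 := by rw [theta_swap1, base001]
  have b100 : (thetaMat 1 0 0).permanent = 2 := by rw [theta_swap2, b010]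
  have b101 : (thetaMat 1 0 1).permanent = 4 := by rw [theta_swap2, base011]
  have b110 : (thetaMat 1 1 0).permanent = 4 := by rw [theta_swap1, b101]
  rw [theta_mod_all]
  have key : ∀ n : ℕ, (n % 2 = 0 ∧ (-1 : ℚ) ^ n = 1) ∨ (n % 2 = 1 ∧ (-1 : ℚ) ^ n = -1) := by
    intro n
    rcases Nat.even_or_odd n with h | h
    · exact Or.inl ⟨Nat.even_iff.mp h, h.neg_one_pow⟩
    · exact Or.inr ⟨Nat.odd_iff.mp h, h.neg_one_pow⟩
  simp only [pow_add]
  rcases key p with ⟨h1, h1'⟩ | ⟨h1, h1'⟩ <;> rcases key q with ⟨h2, h2'⟩ | ⟨h2, h2'⟩ <;>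
    rcases key r with ⟨h3, h3'⟩ | ⟨h3, h3'⟩ <;>
    rw [h1, h1', h2, h2', h3, h3'] <;>
    simp only [base000, base001, base011, base111, b010, b100, b101, b110] <;> norm_num

theorem addPath_rowSum {α : Type} [DecidableEq α] [Fintype α] (N : Matrix α α ℤ) (a b : α)
    (hab : a ≠ b) (p : ℕ) (x : α) :
    ∑ y, addPath N a b p (Sum.inl x) y =
      ∑ y, N x y + (if x = a then 1 else 0) + (if x = b then 1 else 0) := by
  rw [Fintype.sum_sum_type]
  simp only [addPath, Finset.sum_add_distrib]
  rcases Nat.eq_zero_or_pos p with rfl | hp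
  · have : ∀ y, (if True ∧ (x = a ∧ y = b ∨ x = b ∧ y = a) then (1:ℤ) else 0) =
        (if y = b then if x = a then 1 else 0 else 0) +
        (if y = a then if x = b then 1 else 0 else 0) := by
      intro y
      by_cases h1 : x = a <;> by_cases h2 : x = b <;> simp_all
    simp only [eq_self_iff_true, this, Finset.sum_add_distrib, Finset.sum_ite_eq', Finset.mem_univ, if_true,
      Finset.univ_eq_empty, Finset.sum_empty]
    ring
  · have e1 : ∀ i : Fin p, (x = a ∧ i.val = 0) ↔ (i = ⟨0, hp⟩ ∧ x = a) := by
      intro i; simp [Fin.ext_iff, and_comm]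
    have e2 : ∀ i : Fin p, (x = b ∧ i.val + 1 = p) ↔ (i = ⟨p - 1, by omega⟩ ∧ x = b) := by
      intro i; simp only [Fin.ext_iff]; rw [and_comm]; exact and_congr_left fun _ => by omega
    simp [e1, e2, ite_and, hp.ne']
    ring

theorem addPath_rowSum_inr {α : Type} [DecidableEq α] [Fintype α] (N : Matrix α α ℤ) (a b : α)
    (p : ℕ) (i : Fin p) :
    ∑ y, addPath N a b p (Sum.inr i) y = 2 := by
  rw [Fintype.sum_sum_type]
  have hp := i.2
  simp only [addPath, Finset.sum_add_distrib]
  have f1 : ∀ j : Fin p, (if i.val + 1 = j.val ∨ j.val + 1 = i.val then (1:ℤ) else 0) =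
     (if i.val + 1 = j.val then 1 else 0) + (if j.val + 1 = i.val then 1 else 0) := by
    intro j; split_ifs <;> omega
  simp only [f1, Finset.sum_add_distrib]
  have g1 : ∑ j : Fin p, (if i.val + 1 = j.val then (1:ℤ) else 0) =
      if i.val + 1 = p then 0 else 1 := by
    split_ifs with h
    · exact Finset.sum_eq_zero fun j _ => if_neg (by omega)
    · have : ∀ j : Fin p, i.val + 1 = j.val ↔ j = ⟨i.val + 1, by omega⟩ := by
        intro j; simp only [Fin.ext_iff]; omega
      simp [this]
  have g2 : ∑ j : Fin p, (if j.val + 1 = i.val then (1:ℤ) else 0) =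
      if i.val = 0 then 0 else 1 := by
    split_ifs with h
    · exact Finset.sum_eq_zero fun j _ => if_neg (by omega)
    · have : ∀ j : Fin p, j.val + 1 = i.val ↔ j = ⟨i.val - 1, by omega⟩ := by
        intro j; simp only [Fin.ext_iff]; omega
      simp [this]
  rw [g1, g2]
  simp only [ite_and, Finset.sum_ite_eq', Finset.mem_univ, if_true]
  split_ifs <;> rfl

theorem theta_rowSum (p q r : ℕ) (x) : ∑ y, thetaMat p q r x y = 2 := by
  unfold thetaMat
  rcases x with ((x | i) | i) | i
  · rw [addPath_rowSum _ _ _ (by simp), addPath_rowSum _ _ _ (by simp),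
      addPath_rowSum _ _ _ (by simp)]
    fin_cases x <;> simp [Matrix.diagonal_apply]
  · rw [addPath_rowSum _ _ _ (by simp), addPath_rowSum _ _ _ (by simp), addPath_rowSum_inr]
    simp
  · rw [addPath_rowSum _ _ _ (by simp), addPath_rowSum_inr]
    simp
  · rw [addPath_rowSum_inr]

/-- Vertex labelling. -/
def label (p q r : ℕ) : ((Fin 2 ⊕ Fin p) ⊕ Fin q) ⊕ Fin r ≃ Fin (p + q + r + 2) :=
  (((finSumFinEquiv.sumCongr (Equiv.refl _)).trans finSumFinEquiv).sumCongr
    (Equiv.refl _)).trans (finSumFinEquiv.trans (finCongr (by omega)))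

theorem label_hub (p q r : ℕ) (i : Fin 2) :
    (label p q r (Sum.inl (Sum.inl (Sum.inl i)))).val = i.val := by simp [label]
theorem label_p (p q r : ℕ) (i : Fin p) :
    (label p q r (Sum.inl (Sum.inl (Sum.inr i)))).val = 2 + i.val := by simp [label]
theorem label_q (p q r : ℕ) (i : Fin q) :
    (label p q r (Sum.inl (Sum.inr i))).val = 2 + p + i.val := by simp [label]
theorem label_r (p q r : ℕ) (i : Fin r) :
    (label p q r (Sum.inr i)).val = 2 + p + q + i.val := by simp [label]

/-- The relation defining the theta graph, on natural numbers. -/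
def baseRel (p q r i j : ℕ) : Prop :=
    (p = 0 ∧ i = 0 ∧ j = 1) ∨
    (0 < p ∧ i = 0 ∧ j = 2) ∨
    (2 ≤ i ∧ i + 1 = j ∧ j < p + 2) ∨
    (0 < p ∧ i = p + 1 ∧ j = 1) ∨
    (q = 0 ∧ i = 0 ∧ j = 1) ∨
    (0 < q ∧ i = 0 ∧ j = p + 2) ∨
    (p + 2 ≤ i ∧ i + 1 = j ∧ j < p + q + 2) ∨
    (0 < q ∧ i = p + q + 1 ∧ j = 1) ∨
    (r = 0 ∧ i = 0 ∧ j = 1) ∨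
    (0 < r ∧ i = 0 ∧ j = p + q + 2) ∨
    (p + q + 2 ≤ i ∧ i + 1 = j) ∨
    (0 < r ∧ i = p + q + r + 1 ∧ j = 1)

/-- The same relation on the sum type. -/
def sumRel (p q r : ℕ) : ((Fin 2 ⊕ Fin p) ⊕ Fin q) ⊕ Fin r →
    ((Fin 2 ⊕ Fin p) ⊕ Fin q) ⊕ Fin r → Prop
  | .inl (.inl (.inl u)), .inl (.inl (.inl v)) =>
      u.val = 0 ∧ v.val = 1 ∧ (p = 0 ∨ q = 0 ∨ r = 0)
  | .inl (.inl (.inl u)), .inl (.inl (.inr j)) => u.val = 0 ∧ j.val = 0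
  | .inl (.inl (.inl u)), .inl (.inr j) => u.val = 0 ∧ j.val = 0
  | .inl (.inl (.inl u)), .inr j => u.val = 0 ∧ j.val = 0
  | .inl (.inl (.inr i)), .inl (.inl (.inl v)) => i.val + 1 = p ∧ v.val = 1
  | .inl (.inr i), .inl (.inl (.inl v)) => i.val + 1 = q ∧ v.val = 1
  | .inr i, .inl (.inl (.inl v)) => i.val + 1 = r ∧ v.val = 1
  | .inl (.inl (.inr i)), .inl (.inl (.inr j)) => i.val + 1 = j.val
  | .inl (.inr i), .inl (.inr j) => i.val + 1 = j.val
  | .inr i, .inr j => i.val + 1 = j.val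
  | .inl (.inl (.inr _)), .inl (.inr _) => False
  | .inl (.inl (.inr _)), .inr _ => False
  | .inl (.inr _), .inl (.inl (.inr _)) => False
  | .inl (.inr _), .inr _ => False
  | .inr _, .inl (.inl (.inr _)) => False
  | .inr _, .inl (.inr _) => False

theorem baseRel_of (p q r : ℕ) (x y) (h : sumRel p q r x y) :
    baseRel p q r (label p q r x) (label p q r y) := by
  unfold baseRel
  rcases x with ((x | i) | i) | i <;> rcases y with ((y | j) | j) | j <;>
    simp only [label_hub, label_p, label_q, label_r, sumRel] at h ⊢
  · obtain ⟨h1, h2, h3 | h3 | h3⟩ := h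
    · exact Or.inl ⟨h3, h1, h2⟩
    · exact Or.inr (Or.inr (Or.inr (Or.inr (Or.inl ⟨h3, h1, h2⟩))))
    · exact Or.inr (Or.inr (Or.inr (Or.inr (Or.inr (Or.inr (Or.inr (Or.inr
        (Or.inl ⟨h3, h1, h2⟩))))))))
  all_goals repeat (first | (left; omega) | right)
  all_goals omega

theorem of_baseRel (p q r : ℕ) (x y) (h : baseRel p q r (label p q r x) (label p q r y)) :
    sumRel p q r x y := by
  unfold baseRel at h
  rcases x with ((x | i) | i) | i <;> rcases y with ((y | j) | j) | j <;>
    simp only [label_hub, label_p, label_q, label_r, sumRel] at h ⊢ <;>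
    rcases h with h | h | h | h | h | h | h | h | h | h | h | h <;> omega

theorem adj_iff (p q r : ℕ) (x y) (hxy : x ≠ y) :
    (thetaGraph p q r).Adj (label p q r x) (label p q r y) ↔
      sumRel p q r x y ∨ sumRel p q r y x := by
  have hne : label p q r x ≠ label p q r y := (label p q r).injective.ne hxy
  have h1 : (thetaGraph p q r).Adj (label p q r x) (label p q r y) ↔
      label p q r x ≠ label p q r y ∧ (baseRel p q r (label p q r x) (label p q r y) ∨
        baseRel p q r (label p q r y) (label p q r x)) := Iff.rfl
  rw [h1]
  constructor
  · rintro ⟨_, h | h⟩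
    · exact Or.inl (of_baseRel _ _ _ _ _ h)
    · exact Or.inr (of_baseRel _ _ _ _ _ h)
  · rintro (h | h)
    · exact ⟨hne, Or.inl (baseRel_of _ _ _ _ _ h)⟩
    · exact ⟨hne, Or.inr (baseRel_of _ _ _ _ _ h)⟩

theorem thetaMat_offdiag (p q r : ℕ)
    (h0 : (0 < p ∧ 0 < q) ∨ (0 < p ∧ 0 < r) ∨ (0 < q ∧ 0 < r)) (x y) (hxy : x ≠ y) :
    thetaMat p q r x y =
      if (thetaGraph p q r).Adj (label p q r x) (label p q r y) then 1 else 0 := by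
  simp only [adj_iff p q r x y hxy]
  rcases x with ((x | i) | i) | i <;> rcases y with ((y | j) | j) | j <;>
    simp only [sumRel, thetaMat, addPath, Sum.inl.injEq, reduceCtorEq, false_and, and_false,
      or_false, if_false, add_zero, Matrix.diagonal_apply, Fin.ext_iff, Fin.val_zero,
      Fin.val_one] <;>
    simp only [ne_eq, Sum.inl.injEq, Sum.inr.injEq, Fin.ext_iff, reduceCtorEq,
      not_false_eq_true] at hxy
  all_goals split_ifs <;> first | rfl | omega

theorem eq_of_off_row (p q r : ℕ) (A : Matrix (Fin (p + q + r + 2)) (Fin (p + q + r + 2)) ℚ)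
    (off : ∀ x y, x ≠ y → A (label p q r x) (label p q r y) = (thetaMat p q r x y : ℚ))
    (row : ∀ i, ∑ j, A i j = 2) :
    A.submatrix (label p q r) (label p q r) = (thetaMat p q r).map (Int.cast : ℤ → ℚ) := by
  ext x y
  by_cases hxy : x = y
  · subst hxy
    have h1 := row (label p q r x)
    rw [← (label p q r).sum_comp] at h1
    have h2 : ∑ y, (thetaMat p q r x y : ℚ) = 2 := by exact_mod_cast theta_rowSum p q r x
    rw [← Finset.add_sum_erase _ _ (Finset.mem_univ x)] at h1 h2
    rw [Finset.sum_congr rfl fun y hy => off x y (Finset.ne_of_mem_erase hy).symm] at h1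
    simp only [Matrix.submatrix_apply, Matrix.map_apply]
    linarith
  · exact off x y hxy

end helpers

/-- **Lemma 3.2.** The value of the Laplacian permanental polynomial of `θ(p,q,r)` at
`x = 2`. -/
theorem lapPermAtTwo_thetaGraph
    (p q r : ℕ) (h0 : (0 < p ∧ 0 < q) ∨ (0 < p ∧ 0 < r) ∨ (0 < q ∧ 0 < r)) :
    lapPermAtTwo (thetaGraph p q r) =
      7/2 + (1/2) * (-1 : ℚ) ^ (p + r) + (1/2) * (-1 : ℚ) ^ (p + q)
        + (1/2) * (-1 : ℚ) ^ (r + q) + (-1 : ℚ) ^ q + (-1 : ℚ) ^ r + (-1 : ℚ) ^ p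
        + 2 * (-1 : ℚ) ^ (p + q + r) := by
  rw [← theta_value]
  unfold lapPermAtTwo
  have hc : ((thetaMat p q r).permanent : ℚ) =
      ((thetaMat p q r).map (Int.cast : ℤ → ℚ)).permanent := by
    simp [Matrix.permanent]
  rw [hc]
  refine (@perm_equiv _ _ _ _ (_) _ ℚ _ (label p q r) _).symm.trans ?_
  congr 1
  apply eq_of_off_row
  · intro x y hxy
    have hne : label p q r x ≠ label p q r y := (label p q r).injective.ne hxy
    rw [thetaMat_offdiag p q r h0 x y hxy]
    simp [SimpleGraph.lapMatrix, SimpleGraph.degMatrix, Matrix.diagonal_apply, hne,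
      SimpleGraph.adjMatrix_apply]
  · intro i
    have := congrFun ((thetaGraph p q r).lapMatrix_mulVec_const_eq_zero (R := ℚ)) i
    simp [Matrix.mulVec, dotProduct] at this
    have h2 : (∑ x, if i = x then (2 : ℚ) else 0) -
        ∑ x, SimpleGraph.lapMatrix ℚ (thetaGraph p q r) i x = 2 := by
      rw [this]; simp
    simp only [Matrix.sub_apply, Finset.sum_sub_distrib, Matrix.diagonal_apply]
    convert h2
end
end

section
/- Let p, q ≥ 3 and r ≥ 1 be integers. Then the signless Laplacian permanental polynomial of d(p,q,r) evaluated at x = 2 satisfies per(2I − Q(d(p,q,r))) = 1/2 + (3/2)(−1)^p + (3/2)(−1)^q + (9/2)(−1)^{p+q} + 8(−1)^{p+q+r}. -/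
open scoped Classical
open Polynomial

noncomputable section

/-- The signless Laplacian matrix `Q(G) = D(G) + A(G)` of a graph `G`. -/
def signlessLapMatrix {V : Type*} [Fintype V] (G : SimpleGraph V) : Matrix V V ℚ :=
  G.degMatrix ℚ + G.adjMatrix ℚ

/-- The signless Laplacian permanental polynomial of `G` evaluated at `x = 2`:
`per(2·I − Q(G))`. -/
def qPermAtTwo {V : Type*} [Fintype V] (G : SimpleGraph V) : ℚ :=
  Matrix.permanent (Matrix.diagonal (fun _ : V => (2 : ℚ)) - signlessLapMatrix G)

/-- The bicyclic graph `d(p,q,r)` on `p + q + r` vertices: vertices `0, …, p-1` form the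
cycle `C_p`, vertices `p, …, p+q-1` form the cycle `C_q`, and vertices `p+q, …, p+q+r-1`
form a path of `r` internal vertices whose ends are joined to vertex `0` of `C_p` and to
vertex `p` of `C_q` (i.e. a path on `r + 2` vertices has each end vertex identified with a
vertex of one of the two cycles). -/
def dGraph (p q r : ℕ) : SimpleGraph (Fin (p + q + r)) :=
  SimpleGraph.fromRel (fun i j =>
    (i.val + 1 = j.val ∧ j.val < p) ∨
    (i.val = p - 1 ∧ j.val = 0) ∨
    (i.val + 1 = j.val ∧ p ≤ i.val ∧ j.val < p + q) ∨
    (i.val = p + q - 1 ∧ j.val = p) ∨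
    (i.val + 1 = j.val ∧ p + q ≤ i.val) ∨
    (i.val = 0 ∧ j.val = p + q) ∨
    (i.val = p + q + r - 1 ∧ j.val = p))

/-- Coefficient form of the permanent with row set `R` and column set `C`. -/
def subPerAux (N : ℕ) (M : ℕ → ℕ → ℚ) (R C : Finset ℕ) : ℚ :=
  MvPolynomial.coeff (∑ j ∈ C, Finsupp.single j 1)
    (∏ i ∈ R, ∑ j ∈ Finset.range N, MvPolynomial.C (M i j) * MvPolynomial.X j)

lemma single_sum_apply (C : Finset ℕ) (j : ℕ) :
    (∑ k ∈ C, Finsupp.single k 1 : ℕ →₀ ℕ) j = if j ∈ C then 1 else 0 := by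
  simp [Finsupp.finsetSum_apply, Finsupp.single_apply]

lemma subPerAux_row (N : ℕ) (M : ℕ → ℕ → ℚ) (R C : Finset ℕ) (i : ℕ) (hi : i ∉ R)
    (hC : C ⊆ Finset.range N) :
    subPerAux N M (insert i R) C = ∑ j ∈ C, M i j * subPerAux N M R (C.erase j) := by
  unfold subPerAux
  rw [Finset.prod_insert hi, Finset.sum_mul, MvPolynomial.coeff_sum]
  rw [← Finset.sum_subset hC]
  · refine Finset.sum_congr rfl fun j hj => ?_
    rw [mul_assoc, MvPolynomial.coeff_C_mul, MvPolynomial.coeff_X_mul', if_pos]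
    · congr 2
      rw [← Finset.add_sum_erase C _ hj, add_tsub_cancel_left]
    · rw [Finsupp.mem_support_iff, single_sum_apply, if_pos hj]; exact one_ne_zero
  · intro j _ hj
    rw [mul_assoc, MvPolynomial.coeff_C_mul, MvPolynomial.coeff_X_mul', if_neg, mul_zero]
    rw [Finsupp.mem_support_iff, single_sum_apply, if_neg hj]; simp

lemma subPerAux_indep (N N' : ℕ) (M : ℕ → ℕ → ℚ) (R : Finset ℕ) : ∀ C : Finset ℕ,
    C ⊆ Finset.range N → C ⊆ Finset.range N' → subPerAux N M R C = subPerAux N' M R C := by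
  induction R using Finset.induction_on with
  | empty => intro C _ _; simp [subPerAux]
  | insert i R hi ih =>
    intro C h h'
    rw [subPerAux_row _ _ _ _ _ hi h, subPerAux_row _ _ _ _ _ hi h']
    refine Finset.sum_congr rfl fun j _ => ?_
    rw [ih _ ((Finset.erase_subset _ _).trans h) ((Finset.erase_subset _ _).trans h')]

/-- The permanent of the submatrix of `M` with row set `R` and column set `C`
(zero when the two sets have different sizes). -/
def subPer (M : ℕ → ℕ → ℚ) (R C : Finset ℕ) : ℚ := subPerAux (C.sup id + 1) M R C

lemma subset_range_sup (C : Finset ℕ) : C ⊆ Finset.range (C.sup id + 1) := by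
  intro j hj
  have : id j ≤ C.sup id := Finset.le_sup hj
  simp only [id] at this
  simp only [Finset.mem_range]; omega

lemma subPer_eq_aux (M : ℕ → ℕ → ℚ) (R C : Finset ℕ) (N : ℕ) (h : C ⊆ Finset.range N) :
    subPer M R C = subPerAux N M R C :=
  subPerAux_indep _ _ _ _ _ (subset_range_sup C) h

lemma subPer_row (M : ℕ → ℕ → ℚ) (R C : Finset ℕ) (i : ℕ) (hi : i ∉ R) :
    subPer M (insert i R) C = ∑ j ∈ C, M i j * subPer M R (C.erase j) := by
  rw [subPer, subPerAux_row _ _ _ _ _ hi (subset_range_sup C)]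
  refine Finset.sum_congr rfl fun j _ => ?_
  rw [subPer_eq_aux _ _ _ _ ((Finset.erase_subset _ _).trans (subset_range_sup C))]

lemma subPer_empty (M : ℕ → ℕ → ℚ) : subPer M ∅ ∅ = 1 := by
  simp [subPer, subPerAux]

lemma subPer_empty_left (M : ℕ → ℕ → ℚ) (C : Finset ℕ) (h : C.Nonempty) : subPer M ∅ C = 0 := by
  obtain ⟨j, hj⟩ := h
  rw [subPer, subPerAux, Finset.prod_empty, MvPolynomial.coeff_one, if_neg]
  intro h
  have := single_sum_apply C j
  rw [← h, if_pos hj] at this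
  simp at this

lemma subPer_col (M : ℕ → ℕ → ℚ) (R : Finset ℕ) : ∀ (C : Finset ℕ) (j : ℕ), j ∉ C →
    subPer M R (insert j C) = ∑ i ∈ R, M i j * subPer M (R.erase i) C := by
  induction R using Finset.induction_on with
  | empty => intro C j _; rw [subPer_empty_left _ _ (Finset.insert_nonempty _ _)]; simp
  | insert i R hi ih =>
    intro C j hj
    rw [subPer_row _ _ _ _ hi, Finset.sum_insert hj, Finset.erase_insert hj,
      Finset.sum_insert hi, Finset.erase_insert hi]
    congr 1
    have h1 : ∀ k ∈ C, M i k * subPer M R ((insert j C).erase k) =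
        ∑ i' ∈ R, M i' j * (M i k * subPer M (R.erase i') (C.erase k)) := by
      intro k hk
      have hkj : j ≠ k := by rintro rfl; exact hj hk
      rw [Finset.erase_insert_of_ne hkj, ih _ _ (by simp [hj]), Finset.mul_sum]
      refine Finset.sum_congr rfl fun i' _ => by ring
    rw [Finset.sum_congr rfl h1, Finset.sum_comm]
    refine Finset.sum_congr rfl fun i' hi' => ?_
    have hii : i ≠ i' := by rintro rfl; exact hi hi'
    rw [Finset.erase_insert_of_ne hii, subPer_row _ _ _ _ (by simp [hi]), Finset.mul_sum]

lemma subPer_transpose (M : ℕ → ℕ → ℚ) (R : Finset ℕ) : ∀ C : Finset ℕ,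
    subPer M R C = subPer (fun i j => M j i) C R := by
  induction R using Finset.induction_on with
  | empty =>
    intro C
    rcases C.eq_empty_or_nonempty with rfl | h
    · simp [subPer_empty]
    · obtain ⟨j, hj⟩ := h
      rw [subPer_empty_left _ _ ⟨j, hj⟩, ← Finset.insert_erase hj, subPer_row _ _ _ _ (by simp)]
      simp
  | insert i R hi ih =>
    intro C
    rw [subPer_row _ _ _ _ hi, subPer_col _ _ _ _ hi]
    exact Finset.sum_congr rfl fun j _ => by rw [ih]

lemma subPer_univ (n : ℕ) (M : ℕ → ℕ → ℚ) (A : Matrix (Fin n) (Fin n) ℚ)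
    (h : ∀ i j, A j i = M i j) :
    A.permanent = subPer M (Finset.range n) (Finset.range n) := by
  rw [subPer_eq_aux _ _ _ n subset_rfl, subPerAux, Finset.prod_range]
  simp_rw [Finset.sum_range]
  rw [Fintype.prod_sum, MvPolynomial.coeff_sum]
  have h1 : ∀ f : Fin n → Fin n, MvPolynomial.coeff (∑ j : Fin n, Finsupp.single (j : ℕ) 1)
      (∏ i : Fin n, MvPolynomial.C (M i (f i)) * (MvPolynomial.X (f i : ℕ) : MvPolynomial ℕ ℚ)) =
      if Function.Bijective f then ∏ i : Fin n, M i (f i) else 0 := by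
    intro f
    have : ∀ i : Fin n, MvPolynomial.C (M i (f i)) * (MvPolynomial.X (f i : ℕ) : MvPolynomial ℕ ℚ)
        = MvPolynomial.monomial (Finsupp.single (f i : ℕ) 1) (M i (f i)) := by
      intro i; rw [MvPolynomial.C_mul_X_eq_monomial]
    simp_rw [this]
    rw [← MvPolynomial.monomial_sum_prod, MvPolynomial.coeff_monomial]
    refine if_congr ⟨fun hf => ?_, fun hf => ?_⟩ rfl rfl
    · rw [← Finite.surjective_iff_bijective]
      intro j
      have h2 := DFunLike.congr_fun hf (j : ℕ)
      by_contra hc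
      push Not at hc
      simp only [Finsupp.finsetSum_apply, Finsupp.single_apply, Fin.val_inj] at h2
      simp [hc] at h2
    · exact (Equiv.ofBijective f hf).sum_comp (fun j : Fin n => Finsupp.single (j : ℕ) 1)
  simp_rw [h1]
  rw [← Finset.sum_filter, Matrix.permanent]
  symm
  refine Finset.sum_bij (fun p h ↦ Equiv.ofBijective p (Finset.mem_filter.1 h).2)
    (fun _ _ ↦ Finset.mem_univ _) (fun _ _ _ _ h ↦ by injection h)
    (fun b _ ↦ ⟨b, Finset.mem_filter.2 ⟨Finset.mem_univ _, b.bijective⟩, Equiv.coe_fn_injective rfl⟩)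
    fun f hf ↦ ?_
  simp [h]

lemma row_one (M : ℕ → ℕ → ℚ) (R C : Finset ℕ) (i b : ℕ) (hi : i ∈ R) (hb : b ∈ C)
    (h : ∀ j ∈ C, j ≠ b → M i j = 0) :
    subPer M R C = M i b * subPer M (R.erase i) (C.erase b) := by
  conv_lhs => rw [← Finset.insert_erase hi]
  rw [subPer_row _ _ _ _ (by simp)]
  refine Finset.sum_eq_single b (fun j hj hjb => ?_) (fun hb' => absurd hb hb')
  rw [h j hj hjb, zero_mul]

lemma row_two (M : ℕ → ℕ → ℚ) (R C : Finset ℕ) (i b c : ℕ) (hi : i ∈ R) (hb : b ∈ C) (hc : c ∈ C)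
    (hbc : b ≠ c) (h : ∀ j ∈ C, j ≠ b → j ≠ c → M i j = 0) :
    subPer M R C = M i b * subPer M (R.erase i) (C.erase b)
      + M i c * subPer M (R.erase i) (C.erase c) := by
  conv_lhs => rw [← Finset.insert_erase hi]
  rw [subPer_row _ _ _ _ (by simp)]
  refine Finset.sum_eq_add b c hbc (fun j hj hjb => ?_) (fun hb' => absurd hb hb')
    (fun hb' => absurd hc hb')
  rw [h j hj hjb.1 hjb.2, zero_mul]

lemma row_zero (M : ℕ → ℕ → ℚ) (R C : Finset ℕ) (i : ℕ) (hi : i ∈ R)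
    (h : ∀ j ∈ C, M i j = 0) : subPer M R C = 0 := by
  rw [← Finset.insert_erase hi, subPer_row _ _ _ _ (by simp)]
  exact Finset.sum_eq_zero fun j hj => by rw [h j hj, zero_mul]

lemma subPer_symm (M : ℕ → ℕ → ℚ) (hs : ∀ i j, M i j = M j i) (R C : Finset ℕ) :
    subPer M R C = subPer M C R := by
  rw [subPer_transpose]
  congr 1
  funext i j
  exact hs j i

lemma col_one (M : ℕ → ℕ → ℚ) (hs : ∀ i j, M i j = M j i) (R C : Finset ℕ) (i b : ℕ)
    (hi : i ∈ C) (hb : b ∈ R) (h : ∀ j ∈ R, j ≠ b → M i j = 0) :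
    subPer M R C = M i b * subPer M (R.erase b) (C.erase i) := by
  rw [subPer_symm M hs R C, row_one M C R i b hi hb h, subPer_symm M hs]

lemma col_two (M : ℕ → ℕ → ℚ) (hs : ∀ i j, M i j = M j i) (R C : Finset ℕ) (i b c : ℕ)
    (hi : i ∈ C) (hb : b ∈ R) (hc : c ∈ R)
    (hbc : b ≠ c) (h : ∀ j ∈ R, j ≠ b → j ≠ c → M i j = 0) :
    subPer M R C = M i b * subPer M (R.erase b) (C.erase i)
      + M i c * subPer M (R.erase c) (C.erase i) := by
  rw [subPer_symm M hs R C, row_two M C R i b c hi hb hc hbc h, subPer_symm M hs (C.erase i),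
    subPer_symm M hs (C.erase i)]

/-- Expansion at a pendant vertex `a` (possibly with a loop) attached to `b`. -/
lemma leaf (M : ℕ → ℕ → ℚ) (hs : ∀ i j, M i j = M j i) (R C : Finset ℕ) (a b : ℕ)
    (haR : a ∉ R) (haC : a ∉ C) (hbR : b ∈ R) (hbC : b ∈ C)
    (hR : ∀ x ∈ R, x ≠ b → M a x = 0) (hC : ∀ x ∈ C, x ≠ b → M a x = 0) :
    subPer M (insert a R) (insert a C) = M a a * subPer M R C
      + M a b * M a b * subPer M (R.erase b) (C.erase b) := by
  have hab : a ≠ b := by rintro rfl; exact haR hbR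
  rw [row_two M _ _ a a b (by simp) (by simp) (by simp [hbC]) hab (by
    intro j hj h1 h2
    exact hC j (Finset.mem_of_mem_insert_of_ne hj h1) h2)]
  rw [Finset.erase_insert haR, Finset.erase_insert haC]
  rw [col_one M hs R ((insert a C).erase b) a b (by simp [hab]) hbR hR]
  have : ((insert a C).erase b).erase a = C.erase b := by grind
  rw [this]; ring

/-- Indicator of even numbers: the permanent of a loopless path on `k` vertices. -/
def par (k : ℕ) : ℚ := if Even k then 1 else 0

lemma par_add_two (k : ℕ) : par (k + 2) = par k := by
  simp [par, Nat.even_add]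

lemma closed_seg (M : ℕ → ℕ → ℚ) (hs : ∀ i j, M i j = M j i) (R C : Finset ℕ) (k : ℕ) :
    ∀ a : ℕ, (∀ i j, a ≤ i → i < a + k → a ≤ j → j < a + k →
      M i j = if i + 1 = j ∨ j + 1 = i then -1 else 0) →
    (∀ x ∈ R, x < a ∨ a + k ≤ x) → (∀ x ∈ C, x < a ∨ a + k ≤ x) →
    (∀ i x, a ≤ i → i < a + k → (x ∈ R ∨ x ∈ C) → M i x = 0) →
    subPer M (R ∪ Finset.Ico a (a + k)) (C ∪ Finset.Ico a (a + k)) = par k * subPer M R C := by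
  induction k using Nat.twoStepInduction with
  | zero => intro a _ _ _ _; simp [par]
  | one =>
    intro a hseg hR hC hz
    rw [row_zero M _ _ a (by simp)]
    · simp [par]
    · intro j hj
      simp only [Finset.mem_union, Finset.mem_Ico] at hj
      rcases hj with hj | hj
      · exact hz a j le_rfl (by omega) (Or.inr hj)
      · rw [hseg a j (by omega) (by omega) (by omega) (by omega), if_neg (by omega)]
  | more k ih _ =>
    intro a hseg hR hC hz
    have e : ∀ T : Finset ℕ, T ∪ Finset.Ico a (a + (k + 2)) =
        insert a (T ∪ Finset.Ico (a + 1) (a + (k + 2))) := by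
      intro T; ext x; simp only [Finset.mem_union, Finset.mem_Ico, Finset.mem_insert]; grind
    have e2 : ∀ T : Finset ℕ, (∀ x ∈ T, x < a ∨ a + (k + 2) ≤ x) →
        (T ∪ Finset.Ico (a + 1) (a + (k + 2))).erase (a + 1) =
        T ∪ Finset.Ico (a + 2) (a + 2 + k) := by
      intro T hT; ext x
      have := hT x
      simp only [Finset.mem_union, Finset.mem_Ico, Finset.mem_erase]; grind
    have z : ∀ T : Finset ℕ, (∀ x ∈ T, x ∈ R ∨ x ∈ C) →
        ∀ x ∈ T ∪ Finset.Ico (a + 1) (a + (k + 2)), x ≠ a + 1 → M a x = 0 := by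
      intro T hT x hx hxa
      simp only [Finset.mem_union, Finset.mem_Ico] at hx
      rcases hx with hx | hx
      · exact hz a x le_rfl (by omega) (hT x hx)
      · rw [hseg a x (by omega) (by omega) (by omega) (by omega), if_neg (by omega)]
    rw [e R, e C, leaf M hs _ _ a (a + 1)
      (by have := hR a; simp only [Finset.mem_union, Finset.mem_Ico]; grind)
      (by have := hC a; simp only [Finset.mem_union, Finset.mem_Ico]; grind)
      (by simp) (by simp) (z R fun x hx => Or.inl hx) (z C fun x hx => Or.inr hx),
      e2 R hR, e2 C hC, ih (a + 2)]
    · rw [hseg a a (by omega) (by omega) (by omega) (by omega),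
        hseg a (a + 1) (by omega) (by omega) (by omega) (by omega), par_add_two]
      simp
    · intro i j h1 h2 h3 h4; exact hseg i j (by omega) (by omega) (by omega) (by omega)
    · intro x hx; have := hR x hx; omega
    · intro x hx; have := hC x hx; omega
    · intro i x h1 h2 h3; exact hz i x (by omega) (by omega) h3

/-- A loopless path hanging at the vertex `h` (attached at the last vertex of the path). -/
lemma pendant_seg (M : ℕ → ℕ → ℚ) (hs : ∀ i j, M i j = M j i) (R C : Finset ℕ) (h : ℕ)
    (hhR : h ∈ R) (hhC : h ∈ C) (k : ℕ) :
    ∀ a : ℕ, (∀ i j, a ≤ i → i < a + k → a ≤ j → j < a + k →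
      M i j = if i + 1 = j ∨ j + 1 = i then -1 else 0) →
    (∀ x ∈ R, x < a ∨ a + k ≤ x) → (∀ x ∈ C, x < a ∨ a + k ≤ x) →
    (∀ i x, a ≤ i → i < a + k → (x ∈ R ∨ x ∈ C) →
      M i x = if x = h ∧ i + 1 = a + k then -1 else 0) →
    subPer M (R ∪ Finset.Ico a (a + k)) (C ∪ Finset.Ico a (a + k)) = par k * subPer M R C
      + par (k + 1) * subPer M (R.erase h) (C.erase h) := by
  induction k using Nat.twoStepInduction with
  | zero => intro a _ _ _ _; simp [par]
  | one =>
    intro a hseg hR hC hz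
    have e : ∀ T : Finset ℕ, T ∪ Finset.Ico a (a + 1) = insert a T := by
      intro T; ext x; simp only [Finset.mem_union, Finset.mem_Ico, Finset.mem_insert]; grind
    rw [e R, e C, leaf M hs _ _ a h (by have := hR a; grind) (by have := hC a; grind) hhR hhC
      (by intro x hx hxh
          rw [hz a x le_rfl (by omega) (Or.inl hx), if_neg (by tauto)])
      (by intro x hx hxh
          rw [hz a x le_rfl (by omega) (Or.inr hx), if_neg (by tauto)]),
      hseg a a (by omega) (by omega) (by omega) (by omega),
      hz a h le_rfl (by omega) (Or.inl hhR)]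
    simp [par]
  | more k ih _ =>
    intro a hseg hR hC hz
    have e : ∀ T : Finset ℕ, T ∪ Finset.Ico a (a + (k + 2)) =
        insert a (T ∪ Finset.Ico (a + 1) (a + (k + 2))) := by
      intro T; ext x; simp only [Finset.mem_union, Finset.mem_Ico, Finset.mem_insert]; grind
    have e2 : ∀ T : Finset ℕ, (∀ x ∈ T, x < a ∨ a + (k + 2) ≤ x) →
        (T ∪ Finset.Ico (a + 1) (a + (k + 2))).erase (a + 1) =
        T ∪ Finset.Ico (a + 2) (a + 2 + k) := by
      intro T hT; ext x
      have := hT x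
      simp only [Finset.mem_union, Finset.mem_Ico, Finset.mem_erase]; grind
    have z : ∀ T : Finset ℕ, (∀ x ∈ T, x ∈ R ∨ x ∈ C) →
        ∀ x ∈ T ∪ Finset.Ico (a + 1) (a + (k + 2)), x ≠ a + 1 → M a x = 0 := by
      intro T hT x hx hxa
      simp only [Finset.mem_union, Finset.mem_Ico] at hx
      rcases hx with hx | hx
      · rw [hz a x le_rfl (by omega) (hT x hx), if_neg (by omega)]
      · rw [hseg a x (by omega) (by omega) (by omega) (by omega), if_neg (by omega)]
    rw [e R, e C, leaf M hs _ _ a (a + 1)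
      (by have := hR a; simp only [Finset.mem_union, Finset.mem_Ico]; grind)
      (by have := hC a; simp only [Finset.mem_union, Finset.mem_Ico]; grind)
      (by simp) (by simp) (z R fun x hx => Or.inl hx) (z C fun x hx => Or.inr hx),
      e2 R hR, e2 C hC, ih (a + 2)]
    · rw [hseg a a (by omega) (by omega) (by omega) (by omega),
        hseg a (a + 1) (by omega) (by omega) (by omega) (by omega), par_add_two,
        show k + 2 + 1 = k + 1 + 2 by omega, par_add_two]
      simp
    · intro i j h1 h2 h3 h4; exact hseg i j (by omega) (by omega) (by omega) (by omega)
    · intro x hx; have := hR x hx; omega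
    · intro x hx; have := hC x hx; omega
    · intro i x h1 h2 h3
      rw [hz i x (by omega) (by omega) h3]
      refine if_congr ?_ rfl rfl
      omega

/-- Forced chain: rows `a, …, a+k`, columns `a+1, …, a+k` and `h`. -/
lemma shift_seg (M : ℕ → ℕ → ℚ) (R C : Finset ℕ) (h : ℕ) (hhC : h ∈ C) (k : ℕ) :
    ∀ a : ℕ, (∀ i j, a ≤ i → i < a + (k + 1) → a ≤ j → j < a + (k + 1) →
      M i j = if i + 1 = j ∨ j + 1 = i then -1 else 0) →
    (∀ x ∈ R, x < a ∨ a + (k + 1) ≤ x) → (∀ x ∈ C, x < a ∨ a + (k + 1) ≤ x) →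
    (∀ i x, a ≤ i → i < a + (k + 1) → x ∈ C →
      M i x = if x = h ∧ i + 1 = a + (k + 1) then -1 else 0) →
    subPer M (R ∪ Finset.Ico a (a + (k + 1))) (C ∪ Finset.Ico (a + 1) (a + (k + 1)))
      = (-1) ^ (k + 1) * subPer M R (C.erase h) := by
  induction k with
  | zero =>
    intro a hseg hR hC hz
    have e : (R ∪ Finset.Ico a (a + (0 + 1))).erase a = R := by
      ext x; have := hR x
      simp only [Finset.mem_union, Finset.mem_Ico, Finset.mem_erase]; grind
    have e2 : C ∪ Finset.Ico (a + 1) (a + (0 + 1)) = C := by simp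
    rw [e2, row_one M _ _ a h (by simp) hhC, e, hz a h le_rfl (by omega) hhC]
    · simp
    · intro x hx hxh
      rw [hz a x le_rfl (by omega) hx, if_neg (by tauto)]
  | succ k ih =>
    intro a hseg hR hC hz
    have e : (R ∪ Finset.Ico a (a + (k + 1 + 1))).erase a
        = R ∪ Finset.Ico (a + 1) (a + 1 + (k + 1)) := by
      ext x; have := hR x
      simp only [Finset.mem_union, Finset.mem_Ico, Finset.mem_erase]; grind
    have e2 : (C ∪ Finset.Ico (a + 1) (a + (k + 1 + 1))).erase (a + 1)
        = C ∪ Finset.Ico (a + 1 + 1) (a + 1 + (k + 1)) := by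
      ext x; have := hC x
      simp only [Finset.mem_union, Finset.mem_Ico, Finset.mem_erase]; grind
    rw [row_one M _ _ a (a + 1) (by simp) (by simp), e, e2, ih (a + 1)]
    · rw [hseg a (a + 1) (by omega) (by omega) (by omega) (by omega)]
      simp; ring
    · intro i j h1 h2 h3 h4; exact hseg i j (by omega) (by omega) (by omega) (by omega)
    · intro x hx; have := hR x hx; omega
    · intro x hx; have := hC x hx; omega
    · intro i x h1 h2 h3
      rw [hz i x (by omega) (by omega) h3]
      refine if_congr ?_ rfl rfl
      omega
    · intro x hx hxa
      simp only [Finset.mem_union, Finset.mem_Ico] at hx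
      rcases hx with hx | hx
      · rw [hz a x le_rfl (by omega) hx, if_neg (by omega)]
      · rw [hseg a x (by omega) (by omega) (by omega) (by omega), if_neg (by omega)]

/-- Removing a cycle attached at the hub `h`. -/
lemma cycle_seg (M : ℕ → ℕ → ℚ) (hs : ∀ i j, M i j = M j i) (R : Finset ℕ) (h : ℕ)
    (hhR : h ∈ R) (k a : ℕ)
    (hseg : ∀ i j, a ≤ i → i < a + (k + 2) → a ≤ j → j < a + (k + 2) →
      M i j = if i + 1 = j ∨ j + 1 = i then -1 else 0)
    (hR : ∀ x ∈ R, x < a ∨ a + (k + 2) ≤ x)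
    (hz : ∀ i x, a ≤ i → i < a + (k + 2) → x ∈ R →
      M i x = if x = h ∧ (i = a ∨ i + 1 = a + (k + 2)) then -1 else 0) :
    subPer M (R ∪ Finset.Ico a (a + (k + 2))) (R ∪ Finset.Ico a (a + (k + 2)))
      = par k * subPer M R R
      + (2 * par (k + 1) - 2 * (-1) ^ k) * subPer M (R.erase h) (R.erase h) := by
  have hha := hR h hhR
  have z : ∀ x ∈ R ∪ Finset.Ico a (a + (k + 2)), x ≠ h → x ≠ a + 1 → M a x = 0 := by
    intro x hx h1 h2
    simp only [Finset.mem_union, Finset.mem_Ico] at hx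
    rcases hx with hx | hx
    · rw [hz a x le_rfl (by omega) hx, if_neg (by tauto)]
    · rw [hseg a x (by omega) (by omega) (by omega) (by omega), if_neg (by omega)]
  have vh : M a h = -1 := by rw [hz a h le_rfl (by omega) hhR]; simp
  have v1 : M a (a + 1) = -1 := by
    rw [hseg a (a + 1) (by omega) (by omega) (by omega) (by omega)]; simp
  have hseg' : ∀ i j, a + 1 ≤ i → i < a + 1 + (k + 1) → a + 1 ≤ j → j < a + 1 + (k + 1) →
      M i j = if i + 1 = j ∨ j + 1 = i then -1 else 0 := by
    intro i j h1 h2 h3 h4; exact hseg i j (by omega) (by omega) (by omega) (by omega)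
  have hR' : ∀ x ∈ R, x < a + 1 ∨ a + 1 + (k + 1) ≤ x := by
    intro x hx; have := hR x hx; omega
  have hR'' : ∀ x ∈ R.erase h, x < a + 1 ∨ a + 1 + (k + 1) ≤ x := by
    intro x hx; exact hR' x (Finset.mem_of_mem_erase hx)
  have hz' : ∀ i x, a + 1 ≤ i → i < a + 1 + (k + 1) → x ∈ R →
      M i x = if x = h ∧ i + 1 = a + 1 + (k + 1) then -1 else 0 := by
    intro i x h1 h2 h3
    rw [hz i x (by omega) (by omega) h3]
    refine if_congr ?_ rfl rfl
    omega
  -- set bookkeeping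
  have s1 : ((R ∪ Finset.Ico a (a + (k + 2))).erase a).erase h
      = R.erase h ∪ Finset.Ico (a + 1) (a + 1 + (k + 1)) := by
    ext x; have := hR x
    simp only [Finset.mem_union, Finset.mem_Ico, Finset.mem_erase]; grind
  have s2 : ((R ∪ Finset.Ico a (a + (k + 2))).erase h).erase a
      = R.erase h ∪ Finset.Ico (a + 1) (a + 1 + (k + 1)) := by
    rw [Finset.erase_right_comm, s1]
  have s3 : ((R ∪ Finset.Ico a (a + (k + 2))).erase a).erase (a + 1)
      = R ∪ Finset.Ico (a + 2) (a + 2 + k) := by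
    ext x; have := hR x
    simp only [Finset.mem_union, Finset.mem_Ico, Finset.mem_erase]; grind
  have s4 : ((R ∪ Finset.Ico a (a + (k + 2))).erase (a + 1)).erase a
      = R ∪ Finset.Ico (a + 2) (a + 2 + k) := by
    rw [Finset.erase_right_comm, s3]
  have s5 : R ∪ Finset.Ico (a + 2) (a + 2 + k) =
      R ∪ Finset.Ico (a + 1 + 1) (a + 1 + (k + 1)) := by
    congr 2; omega
  rw [row_two M _ _ a h (a + 1) (by simp) (by simp [hhR]) (by simp) (by omega) z]
  rw [col_two M hs ((R ∪ Finset.Ico a (a + (k + 2))).erase a)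
    ((R ∪ Finset.Ico a (a + (k + 2))).erase h) a h (a + 1)
    (by simp; omega) (by simp [hhR]; omega) (by simp) (by omega)
    (fun x hx => z x (Finset.mem_of_mem_erase hx))]
  rw [col_two M hs ((R ∪ Finset.Ico a (a + (k + 2))).erase a)
    ((R ∪ Finset.Ico a (a + (k + 2))).erase (a + 1)) a h (a + 1)
    (by simp) (by simp [hhR]; omega) (by simp) (by omega)
    (fun x hx => z x (Finset.mem_of_mem_erase hx))]
  rw [s1, s2, s3, s4, vh, v1]
  rw [closed_seg M hs (R.erase h) (R.erase h) (k + 1) (a + 1) hseg' hR'' hR'' (by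
    intro i x h1 h2 h3
    have h4 : x ∈ R.erase h := by tauto
    rw [hz' i x h1 h2 (Finset.mem_of_mem_erase h4), if_neg]
    have := Finset.ne_of_mem_erase h4
    tauto)]
  rw [pendant_seg M hs R R h hhR hhR k (a + 2)
    (by intro i j h1 h2 h3 h4; exact hseg i j (by omega) (by omega) (by omega) (by omega))
    (by intro x hx; have := hR x hx; omega) (by intro x hx; have := hR x hx; omega)
    (by
      intro i x h1 h2 h3
      rw [hz i x (by omega) (by omega) (by tauto)]
      refine if_congr ?_ rfl rfl
      omega)]
  rw [subPer_symm M hs (R ∪ Finset.Ico (a + 2) (a + 2 + k)), s5,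
    shift_seg M (R.erase h) R h hhR k (a + 1) hseg' hR'' hR' hz']
  ring

/-- Adjacency of `d(p,q,r)` on natural number labels. -/
def adjN (p q r i j : ℕ) : Prop :=
  i ≠ j ∧
  (((i + 1 = j ∧ j < p) ∨ (i = p - 1 ∧ j = 0) ∨ (i + 1 = j ∧ p ≤ i ∧ j < p + q) ∨
    (i = p + q - 1 ∧ j = p) ∨ (i + 1 = j ∧ p + q ≤ i) ∨ (i = 0 ∧ j = p + q) ∨
    (i = p + q + r - 1 ∧ j = p)) ∨
   ((j + 1 = i ∧ i < p) ∨ (j = p - 1 ∧ i = 0) ∨ (j + 1 = i ∧ p ≤ j ∧ i < p + q) ∨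
    (j = p + q - 1 ∧ i = p) ∨ (j + 1 = i ∧ p + q ≤ j) ∨ (j = 0 ∧ i = p + q) ∨
    (j = p + q + r - 1 ∧ i = p)))

/-- The matrix `2I - Q` of `d(p,q,r)` on natural number labels. -/
def dMat (p q r i j : ℕ) : ℚ :=
  if i = j then (if i = 0 ∨ i = p then -1 else 0) else if adjN p q r i j then -1 else 0

lemma dGraph_adj (p q r : ℕ) (i j : Fin (p + q + r)) :
    (dGraph p q r).Adj i j ↔ adjN p q r i j := by
  rw [dGraph, SimpleGraph.fromRel_adj, adjN, ne_eq, ne_eq, Fin.ext_iff]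

lemma adjN_symm (p q r i j : ℕ) : adjN p q r i j ↔ adjN p q r j i := by
  unfold adjN
  rw [ne_comm, or_comm]

lemma adjN_succ (p q r i j : ℕ) (h : i + 1 = j) (h1 : j ≠ p) (h2 : j ≠ p + q) :
    adjN p q r i j := by
  refine ⟨by omega, Or.inl ?_⟩
  rcases lt_or_ge j p with h3 | h3
  · exact Or.inl ⟨h, h3⟩
  · rcases lt_or_ge j (p + q) with h4 | h4
    · exact Or.inr (Or.inr (Or.inl ⟨h, by omega, h4⟩))
    · exact Or.inr (Or.inr (Or.inr (Or.inr (Or.inl ⟨h, by omega⟩))))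

lemma adjN_zero_left (p q r j : ℕ) (hp : 3 ≤ p) (h : j = p - 1 ∨ j = p + q) :
    adjN p q r 0 j := by
  rcases h with h | h
  · exact ⟨by omega, Or.inr (Or.inr (Or.inl ⟨h, rfl⟩))⟩
  · exact ⟨by omega, Or.inl (Or.inr (Or.inr (Or.inr (Or.inr (Or.inr (Or.inl ⟨rfl, h⟩))))))⟩

lemma adjN_hub_left (p q r j : ℕ) (hq : 3 ≤ q) (h : j = p + q - 1 ∨ j = p + q + r - 1) :
    adjN p q r p j := by
  rcases h with h | h
  · exact ⟨by omega, Or.inr (Or.inr (Or.inr (Or.inr (Or.inl ⟨h, rfl⟩))))⟩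
  · exact ⟨by omega, Or.inr (Or.inr (Or.inr (Or.inr (Or.inr (Or.inr (Or.inr ⟨h, rfl⟩))))))⟩

lemma adjN_elim (p q r i j : ℕ) (hp : 3 ≤ p) (hq : 3 ≤ q) (hr : 1 ≤ r)
    (h : adjN p q r i j) (hij : i < j) (hj : j < p + q + r) :
    (i + 1 = j ∧ j ≠ p ∧ j ≠ p + q) ∨ (i = 0 ∧ (j = p - 1 ∨ j = p + q)) ∨
      (i = p ∧ (j = p + q - 1 ∨ j = p + q + r - 1)) := by
  obtain ⟨hne, (h | h | h | h | h | h | h) | (h | h | h | h | h | h | h)⟩ := h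
  · left; omega
  · omega
  · left; omega
  · omega
  · left; omega
  · right; left; omega
  · omega
  · omega
  · right; left; omega
  · omega
  · right; right; omega
  · omega
  · omega
  · right; right; omega

lemma adjN_iff (p q r i j : ℕ) (hp : 3 ≤ p) (hq : 3 ≤ q) (hr : 1 ≤ r)
    (hij : i < j) (hj : j < p + q + r) :
    adjN p q r i j ↔ (i + 1 = j ∧ j ≠ p ∧ j ≠ p + q) ∨ (i = 0 ∧ (j = p - 1 ∨ j = p + q)) ∨
      (i = p ∧ (j = p + q - 1 ∨ j = p + q + r - 1)) := by
  refine ⟨fun h => adjN_elim p q r i j hp hq hr h hij hj, ?_⟩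
  rintro (h | ⟨rfl, h⟩ | ⟨rfl, h⟩)
  · exact adjN_succ _ _ _ _ _ h.1 h.2.1 h.2.2
  · exact adjN_zero_left _ _ _ _ hp h
  · exact adjN_hub_left _ _ _ _ hq h

lemma adjN_cases (p q r i j : ℕ) (hp : 3 ≤ p) (hq : 3 ≤ q) (hr : 1 ≤ r)
    (hi : i < p + q + r) (hj : j < p + q + r) :
    adjN p q r i j ↔
      (i < j ∧ ((i + 1 = j ∧ j ≠ p ∧ j ≠ p + q) ∨ (i = 0 ∧ (j = p - 1 ∨ j = p + q)) ∨
      (i = p ∧ (j = p + q - 1 ∨ j = p + q + r - 1)))) ∨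
      (j < i ∧ ((j + 1 = i ∧ i ≠ p ∧ i ≠ p + q) ∨ (j = 0 ∧ (i = p - 1 ∨ i = p + q)) ∨
      (j = p ∧ (i = p + q - 1 ∨ i = p + q + r - 1)))) := by
  rcases lt_trichotomy i j with h | h | h
  · rw [adjN_iff p q r i j hp hq hr h hj]
    simp [h, h.le]
  · subst h; simp [adjN]
  · rw [adjN_symm, adjN_iff p q r j i hp hq hr h hi]
    simp [h, h.le]

lemma nbr_exists (p q r : ℕ) (hp : 3 ≤ p) (hq : 3 ≤ q) (hr : 1 ≤ r) (i : ℕ)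
    (hi : i < p + q + r) (h0 : ¬ (i = 0 ∨ i = p)) :
    ∃ x y, x ≠ y ∧ ∀ j, (j < p + q + r ∧ adjN p q r i j) ↔ j = x ∨ j = y := by
  have fin : ∀ x y, x < p + q + r → y < p + q + r → x ≠ y →
      (∀ j, j < p + q + r → (adjN p q r i j ↔ j = x ∨ j = y)) →
      ∃ x y, x ≠ y ∧ ∀ j, (j < p + q + r ∧ adjN p q r i j) ↔ j = x ∨ j = y := by
    intro x y hx hy hxy h
    refine ⟨x, y, hxy, fun j => ⟨fun hj => (h j hj.1).1 hj.2, fun hj => ?_⟩⟩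
    have hj' : j < p + q + r := by omega
    exact ⟨hj', (h j hj').2 hj⟩
  by_cases c1 : i = p - 1
  · refine fin (i - 1) 0 (by omega) (by omega) (by omega) fun j hj => ?_
    rw [adjN_cases p q r i j hp hq hr hi hj]; omega
  by_cases c2 : i = p + q - 1
  · refine fin (i - 1) p (by omega) (by omega) (by omega) fun j hj => ?_
    rw [adjN_cases p q r i j hp hq hr hi hj]; omega
  by_cases c3 : i = p + q
  · by_cases c4 : i = p + q + r - 1
    · refine fin 0 p (by omega) (by omega) (by omega) fun j hj => ?_
      rw [adjN_cases p q r i j hp hq hr hi hj]; omega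
    · refine fin 0 (i + 1) (by omega) (by omega) (by omega) fun j hj => ?_
      rw [adjN_cases p q r i j hp hq hr hi hj]; omega
  by_cases c4 : i = p + q + r - 1
  · refine fin (i - 1) p (by omega) (by omega) (by omega) fun j hj => ?_
    rw [adjN_cases p q r i j hp hq hr hi hj]; omega
  · refine fin (i - 1) (i + 1) (by omega) (by omega) (by omega) fun j hj => ?_
    rw [adjN_cases p q r i j hp hq hr hi hj]; omega

lemma dGraph_degree (p q r : ℕ) (hp : 3 ≤ p) (hq : 3 ≤ q) (hr : 1 ≤ r) (i : Fin (p + q + r)) :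
    (dGraph p q r).degree i = if i.val = 0 ∨ i.val = p then 3 else 2 := by
  have key : ∀ S : Finset ℕ,
      (∀ j, (j < p + q + r ∧ adjN p q r i j) ↔ j ∈ S) → (dGraph p q r).degree i = S.card := by
    intro S hS
    rw [← SimpleGraph.card_neighborFinset_eq_degree, ← Finset.card_map Fin.valEmbedding]
    congr 1
    ext j
    rw [← hS j]
    simp only [Finset.mem_map, SimpleGraph.mem_neighborFinset, dGraph_adj, Fin.valEmbedding_apply]
    constructor
    · rintro ⟨a, ha, rfl⟩; exact ⟨a.2, ha⟩
    · rintro ⟨h1, h2⟩; exact ⟨⟨j, h1⟩, h2, rfl⟩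
  have hi := i.2
  split_ifs with h
  · rcases h with h | h
    · rw [key {1, p - 1, p + q} (by
        intro j
        simp only [Finset.mem_insert, Finset.mem_singleton]
        constructor
        · rintro ⟨hj, h2⟩
          rw [adjN_cases p q r i j hp hq hr hi hj] at h2
          omega
        · intro h2
          have hj : j < p + q + r := by omega
          refine ⟨hj, ?_⟩
          rw [adjN_cases p q r i j hp hq hr hi hj]
          omega)]
      rw [Finset.card_eq_three]
      exact ⟨_, _, _, by omega, by omega, by omega, rfl⟩
    · rw [key {p + 1, p + q - 1, p + q + r - 1} (by
        intro j
        simp only [Finset.mem_insert, Finset.mem_singleton]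
        constructor
        · rintro ⟨hj, h2⟩
          rw [adjN_cases p q r i j hp hq hr hi hj] at h2
          omega
        · intro h2
          have hj : j < p + q + r := by omega
          refine ⟨hj, ?_⟩
          rw [adjN_cases p q r i j hp hq hr hi hj]
          omega)]
      rw [Finset.card_eq_three]
      exact ⟨_, _, _, by omega, by omega, by omega, rfl⟩
  · obtain ⟨x, y, hxy, hS⟩ := nbr_exists p q r hp hq hr i i.2 h
    rw [key {x, y} (by intro j; rw [hS]; simp), Finset.card_pair hxy]

lemma dMat_symm (p q r i j : ℕ) : dMat p q r i j = dMat p q r j i := by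
  unfold dMat
  by_cases h : i = j
  · subst h; rfl
  · rw [if_neg h, if_neg (Ne.symm h)]
    exact if_congr (adjN_symm _ _ _ _ _) rfl rfl

lemma dMat_zero (p q r i j : ℕ) (h : i ≠ j) (h' : ¬ adjN p q r i j) : dMat p q r i j = 0 := by
  rw [dMat, if_neg h, if_neg h']

lemma dMat_adj (p q r i j : ℕ) (h' : adjN p q r i j) : dMat p q r i j = -1 := by
  rw [dMat, if_neg h'.1, if_pos h']

lemma dMat_inner (p q r i j : ℕ) (hi0 : i ≠ 0) (hip : i ≠ p) (hj0 : j ≠ 0) (hjp : j ≠ p)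
    (h : (i < p ∧ j < p) ∨ (p < i ∧ i < p + q ∧ p < j ∧ j < p + q) ∨ (p + q ≤ i ∧ p + q ≤ j)) :
    dMat p q r i j = if i + 1 = j ∨ j + 1 = i then -1 else 0 := by
  by_cases hij : i = j
  · rw [dMat, if_pos hij, if_neg (by omega), if_neg (by omega)]
  · by_cases hc : i + 1 = j ∨ j + 1 = i
    · rw [if_pos hc]
      apply dMat_adj
      refine ⟨hij, ?_⟩
      rcases hc with hc | hc
      · left
        rcases h with h | h | h
        · left; omega
        · right; right; left; omega
        · right; right; right; right; left; omega
      · right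
        rcases h with h | h | h
        · left; omega
        · right; right; left; omega
        · right; right; right; right; left; omega
    · rw [if_neg hc]
      apply dMat_zero _ _ _ _ _ hij
      rintro ⟨-, (h | h | h | h | h | h | h) | (h | h | h | h | h | h | h)⟩ <;> omega

lemma qPerm_eq (p q r : ℕ) (hp : 3 ≤ p) (hq : 3 ≤ q) (hr : 1 ≤ r) :
    qPermAtTwo (dGraph p q r) =
      subPer (dMat p q r) (Finset.range (p + q + r)) (Finset.range (p + q + r)) := by
  unfold qPermAtTwo
  have : ∀ (d : DecidableEq (Fin (p + q + r))) (A : Matrix (Fin (p + q + r)) (Fin (p + q + r)) ℚ),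
      (∀ i j, A j i = dMat p q r i j) → @Matrix.permanent _ d _ _ _ A =
      subPer (dMat p q r) (Finset.range (p + q + r)) (Finset.range (p + q + r)) := by
    intro d A hA
    rw [← subPer_univ _ _ A hA]
    congr
  apply this
  intro i j
  rw [dMat_symm]
  simp only [signlessLapMatrix, Matrix.sub_apply, Matrix.add_apply, SimpleGraph.degMatrix,
    SimpleGraph.adjMatrix_apply, Matrix.diagonal_apply, dGraph_adj, dMat]
  by_cases h : j = i
  · subst h
    have : ¬ adjN p q r j j := by simp [adjN]
    simp only [if_true, this, if_false, dGraph_degree p q r hp hq hr]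
    split_ifs <;> norm_num
  · have h' : (j : ℕ) ≠ i := fun h2 => h (Fin.ext h2)
    simp only [if_neg h, if_neg h']
    split_ifs <;> norm_num

lemma par_eq (k : ℕ) : par k = (1 + (-1) ^ k) / 2 := by
  unfold par
  rcases Nat.even_or_odd k with h | h
  · rw [if_pos h, h.neg_one_pow]; norm_num
  · rw [if_neg (Nat.not_even_iff_odd.2 h), h.neg_one_pow]; norm_num

lemma path_end (p q r : ℕ) (hp : 3 ≤ p) (hq : 3 ≤ q) (hr : 1 ≤ r) (s k : ℕ) (hs : p + q ≤ s)
    (hk : s + k = p + q + r) :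
    subPer (dMat p q r) ({p} ∪ Finset.Ico s (s + k)) ({p} ∪ Finset.Ico s (s + k)) =
      - par k + par (k + 1) := by
  rw [pendant_seg (dMat p q r) (dMat_symm p q r) {p} {p} p (by simp) (by simp)]
  · have e : subPer (dMat p q r) {p} {p} = -1 := by
      rw [row_one _ _ _ p p (by simp) (by simp) (by simp)]
      simp [subPer_empty, dMat]
    rw [e]; simp [subPer_empty]
  · intro i j h1 h2 h3 h4
    exact dMat_inner _ _ _ _ _ (by omega) (by omega) (by omega) (by omega) (by omega)
  · intro x hx; simp at hx; omega
  · intro x hx; simp at hx; omega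
  · intro i x h1 h2 h3
    simp only [Finset.mem_singleton, or_self] at h3
    subst h3
    split_ifs with hc
    · refine dMat_adj _ _ _ _ _ ?_
      rw [adjN_cases _ _ _ _ _ hp hq hr (by omega) (by omega)]
      omega
    · refine dMat_zero _ _ _ _ _ (by omega) ?_
      rw [adjN_cases _ _ _ _ _ hp hq hr (by omega) (by omega)]
      omega

lemma path_free (p q r : ℕ) (hp : 3 ≤ p) (hq : 3 ≤ q) (s k : ℕ) (hs : p + q ≤ s)
    (hk : s + k = p + q + r) :
    subPer (dMat p q r) (Finset.Ico s (s + k)) (Finset.Ico s (s + k)) = par k := by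
  have := closed_seg (dMat p q r) (dMat_symm p q r) ∅ ∅ k s ?_ (by simp) (by simp) (by simp)
  · simpa [subPer_empty] using this
  · intro i j h1 h2 h3 h4
    exact dMat_inner _ _ _ _ _ (by omega) (by omega) (by omega) (by omega) (by omega)

/-- Removing the second cycle. -/
lemma second_cycle (p l r : ℕ) (hp : 3 ≤ p) (hq : 3 ≤ l + 3) (hr : 1 ≤ r) (R : Finset ℕ) (hpR : p ∈ R)
    (hR : ∀ x ∈ R, x = 0 ∨ x = p ∨ p + (l + 3) ≤ x ∧ x < p + (l + 3) + r) :
    subPer (dMat p (l + 3) r) (R ∪ Finset.Ico (p + 1) (p + 1 + (l + 2)))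
      (R ∪ Finset.Ico (p + 1) (p + 1 + (l + 2))) = par l * subPer (dMat p (l + 3) r) R R
      + (2 * par (l + 1) - 2 * (-1) ^ l) *
        subPer (dMat p (l + 3) r) (R.erase p) (R.erase p) := by
  apply cycle_seg _ (dMat_symm _ _ _) _ _ hpR
  · intro i j h1 h2 h3 h4
    exact dMat_inner _ _ _ _ _ (by omega) (by omega) (by omega) (by omega) (by omega)
  · intro x hx; have := hR x hx; omega
  · intro i x h1 h2 h3
    have := hR x h3
    split_ifs with hc
    · refine dMat_adj _ _ _ _ _ ?_
      rw [adjN_cases _ _ _ _ _ hp hq hr (by omega) (by omega)]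
      omega
    · refine dMat_zero _ _ _ _ _ (by omega) ?_
      rw [adjN_cases _ _ _ _ _ hp hq hr (by omega) (by omega)]
      omega

/-- Removing the first cycle. -/
lemma first_cycle (k q r : ℕ) (hp : 3 ≤ k + 3) (hq : 3 ≤ q) (hr : 1 ≤ r) (R : Finset ℕ) (h0R : 0 ∈ R)
    (hR : ∀ x ∈ R, x = 0 ∨ k + 3 ≤ x ∧ x < k + 3 + q + r) :
    subPer (dMat (k + 3) q r) (R ∪ Finset.Ico 1 (1 + (k + 2)))
      (R ∪ Finset.Ico 1 (1 + (k + 2))) = par k * subPer (dMat (k + 3) q r) R R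
      + (2 * par (k + 1) - 2 * (-1) ^ k) *
        subPer (dMat (k + 3) q r) (R.erase 0) (R.erase 0) := by
  apply cycle_seg _ (dMat_symm _ _ _) _ _ h0R
  · intro i j h1 h2 h3 h4
    exact dMat_inner _ _ _ _ _ (by omega) (by omega) (by omega) (by omega) (by omega)
  · intro x hx; have := hR x hx; omega
  · intro i x h1 h2 h3
    have := hR x h3
    split_ifs with hc
    · refine dMat_adj _ _ _ _ _ ?_
      rw [adjN_cases _ _ _ _ _ hp hq hr (by omega) (by omega)]
      omega
    · refine dMat_zero _ _ _ _ _ (by omega) ?_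
      rw [adjN_cases _ _ _ _ _ hp hq hr (by omega) (by omega)]
      omega

/-- Expanding at the hub `0` once its cycle is removed. -/
lemma hub_leaf (p q r : ℕ) (hp : 3 ≤ p) (hq : 3 ≤ q) (hr : 1 ≤ r) (R : Finset ℕ) (hb : p + q ∈ R)
    (hR : ∀ x ∈ R, x = p ∨ p + q ≤ x ∧ x < p + q + r) :
    subPer (dMat p q r) (insert 0 R) (insert 0 R) = - subPer (dMat p q r) R R
      + subPer (dMat p q r) (R.erase (p + q)) (R.erase (p + q)) := by
  have h0 : 0 ∉ R := by intro h; have := hR 0 h; omega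
  have z : ∀ x ∈ R, x ≠ p + q → dMat p q r 0 x = 0 := by
    intro x hx hne
    have := hR x hx
    refine dMat_zero _ _ _ _ _ (by omega) ?_
    rw [adjN_cases _ _ _ _ _ hp hq hr (by omega) (by omega)]
    omega
  have v : dMat p q r 0 (p + q) = -1 := by
    exact dMat_adj _ _ _ _ _ (adjN_zero_left _ _ _ _ hp (Or.inr rfl))
  have v0 : dMat p q r 0 0 = -1 := by simp [dMat]
  rw [leaf _ (dMat_symm _ _ _) R R 0 (p + q) h0 h0 hb hb z z, v, v0]
  ring

/-- **Lemma 4.1.** The value of the signless Laplacian permanental polynomial of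
`d(p,q,r)` at `x = 2`. -/
theorem qPermAtTwo_dGraph
    (p q r : ℕ) (hp : 3 ≤ p) (hq : 3 ≤ q) (hr : 1 ≤ r) :
    qPermAtTwo (dGraph p q r) =
      1/2 + (3/2) * (-1 : ℚ) ^ p + (3/2) * (-1 : ℚ) ^ q + (9/2) * (-1 : ℚ) ^ (p + q)
        + 8 * (-1 : ℚ) ^ (p + q + r) := by
  rw [qPerm_eq p q r hp hq hr]
  obtain ⟨k, rfl⟩ := Nat.exists_eq_add_of_le' hp
  obtain ⟨l, rfl⟩ := Nat.exists_eq_add_of_le' hq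
  obtain ⟨t, rfl⟩ := Nat.exists_eq_add_of_le' hr
  set n := k + 3 + (l + 3) with hn
  have e1 : Finset.range (n + (t + 1)) =
      insert 0 (Finset.Ico (k + 3) (n + (t + 1))) ∪ Finset.Ico 1 (1 + (k + 2)) := by
    ext x; simp only [Finset.mem_range, Finset.mem_union, Finset.mem_insert, Finset.mem_Ico]; omega
  have e2 : (insert 0 (Finset.Ico (k + 3) (n + (t + 1)))).erase 0
      = Finset.Ico (k + 3) (n + (t + 1)) := Finset.erase_insert (by simp)
  have e3 : insert 0 (Finset.Ico (k + 3) (n + (t + 1))) =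
      insert 0 ({k + 3} ∪ Finset.Ico n (n + (t + 1)))
        ∪ Finset.Ico (k + 3 + 1) (k + 3 + 1 + (l + 2)) := by
    ext x
    simp only [Finset.mem_union, Finset.mem_insert, Finset.mem_Ico, Finset.mem_singleton]; omega
  have e4 : Finset.Ico (k + 3) (n + (t + 1)) =
      ({k + 3} ∪ Finset.Ico n (n + (t + 1)))
        ∪ Finset.Ico (k + 3 + 1) (k + 3 + 1 + (l + 2)) := by
    ext x
    simp only [Finset.mem_union, Finset.mem_Ico, Finset.mem_singleton]; omega
  have e5 : (insert 0 ({k + 3} ∪ Finset.Ico n (n + (t + 1)))).erase (k + 3)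
      = insert 0 (Finset.Ico n (n + (t + 1))) := by
    ext x
    simp only [Finset.mem_union, Finset.mem_insert, Finset.mem_Ico, Finset.mem_singleton,
      Finset.mem_erase]; omega
  have e6 : ({k + 3} ∪ Finset.Ico n (n + (t + 1))).erase (k + 3)
      = Finset.Ico n (n + (t + 1)) := by
    ext x
    simp only [Finset.mem_union, Finset.mem_Ico, Finset.mem_singleton,
      Finset.mem_erase]; omega
  have e7 : ({k + 3} ∪ Finset.Ico n (n + (t + 1))).erase n
      = {k + 3} ∪ Finset.Ico (n + 1) (n + 1 + t) := by
    ext x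
    simp only [Finset.mem_union, Finset.mem_Ico, Finset.mem_singleton,
      Finset.mem_erase]; omega
  have e8 : (Finset.Ico n (n + (t + 1))).erase n = Finset.Ico (n + 1) (n + 1 + t) := by
    ext x
    simp only [Finset.mem_Ico, Finset.mem_erase]; omega
  rw [e1, first_cycle k (l + 3) (t + 1) hp hq hr _ (by simp) (by
    intro x hx; simp only [Finset.mem_insert, Finset.mem_Ico] at hx; omega), e2, e3, e4]
  rw [second_cycle (k + 3) l (t + 1) hp hq hr _ (by simp) (by
    intro x hx
    simp only [Finset.mem_union, Finset.mem_insert, Finset.mem_Ico, Finset.mem_singleton] at hx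
    omega), e5]
  rw [second_cycle (k + 3) l (t + 1) hp hq hr _ (by simp) (by
    intro x hx
    simp only [Finset.mem_union, Finset.mem_Ico, Finset.mem_singleton] at hx
    omega), e6]
  rw [hub_leaf (k + 3) (l + 3) (t + 1) hp hq hr _ (by simp [← hn]) (by
    intro x hx
    simp only [Finset.mem_union, Finset.mem_Ico, Finset.mem_singleton] at hx
    omega)]
  rw [hub_leaf (k + 3) (l + 3) (t + 1) hp hq hr (Finset.Ico n (n + (t + 1))) (by simp [← hn]) (by
    intro x hx
    simp only [Finset.mem_Ico] at hx
    omega)]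
  rw [← hn, e7, e8, path_end _ _ _ hp hq hr n (t + 1) (by omega) (by omega),
    path_end _ _ _ hp hq hr (n + 1) t (by omega) (by omega),
    path_free _ _ _ hp hq n (t + 1) (by omega) (by omega),
    path_free _ _ _ hp hq (n + 1) t (by omega) (by omega)]
  simp only [par_eq, hn]
  rcases neg_one_pow_eq_or ℚ k with h1 | h1 <;> rcases neg_one_pow_eq_or ℚ l with h2 | h2 <;>
    rcases neg_one_pow_eq_or ℚ t with h3 | h3 <;> simp only [pow_add, h1, h2, h3] <;> norm_num
end
end

section
/- Let p, q, r ≥ 0 be integers with at most one of them equal to 0. Then the signless Laplacian permanental polynomial of θ(p,q,r) evaluated at x = 2 satisfies per(2I − Q(θ(p,q,r))) = 1/2 + (3/2)(−1)^{p+r} + (3/2)(−1)^{p+q} + (3/2)(−1)^{r+q} + 5(−1)^{p+q+r}. -/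
open scoped Classical
open Polynomial

noncomputable section

open Matrix in
lemma perm_expand {W : Type*} [Fintype W] [DecidableEq W]
    (N : Matrix (Option W) (Option W) ℚ) :
    N.permanent = N none none * (N.submatrix some some).permanent
      + ∑ w, N (some w) none *
        ((N.submatrix some some).updateRow w (fun y => N none (some y))).permanent := by
  unfold Matrix.permanent
  rw [← Equiv.sum_comp (Equiv.Perm.decomposeOption (α := W)).symm, Fintype.sum_prod_type,
    Fintype.sum_option]
  congr 1
  · rw [Finset.mul_sum]
    refine Finset.sum_congr rfl fun τ _ => ?_
    rw [Fintype.prod_option]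
    simp
  · refine Finset.sum_congr rfl fun w _ => ?_
    rw [Finset.mul_sum]
    refine Finset.sum_congr rfl fun τ _ => ?_
    rw [Fintype.prod_option]
    simp only [Equiv.Perm.decomposeOption_symm_apply, Equiv.Perm.coe_mul, Function.comp_apply,
      Equiv.optionCongr_apply, Option.map_none, Option.map_some, Equiv.swap_apply_left]
    congr 1
    refine Finset.prod_congr rfl fun x _ => ?_
    by_cases h : τ x = w
    · simp [h, Matrix.updateRow_apply]
    · have : (some (τ x)) ≠ some w := by simpa using h
      simp [h, Matrix.updateRow_apply, Equiv.swap_apply_of_ne_of_ne, this]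

lemma perm_updateRow_add {W : Type*} [Fintype W] [DecidableEq W]
    (N : Matrix W W ℚ) (w : W) (f g : W → ℚ) :
    (N.updateRow w (f + g)).permanent
      = (N.updateRow w f).permanent + (N.updateRow w g).permanent := by
  unfold Matrix.permanent
  rw [← Finset.sum_add_distrib]
  refine Finset.sum_congr rfl fun τ _ => ?_
  have key : ∀ h : W → ℚ, ∏ i, N.updateRow w h (τ i) i
      = h (τ.symm w) * ∏ i ∈ Finset.univ.erase (τ.symm w), N (τ i) i := by
    intro h
    rw [← Finset.mul_prod_erase _ _ (Finset.mem_univ (τ.symm w))]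
    congr 1
    · simp
    · refine Finset.prod_congr rfl fun i hi => ?_
      have : τ i ≠ w := by
        rintro rfl
        simp at hi
      rw [Matrix.updateRow_ne this]
  rw [key, key, key, Pi.add_apply, add_mul]

lemma perm_contract {W : Type*} [Fintype W] [DecidableEq W]
    (N : Matrix (Option (Option W)) (Option (Option W)) ℚ) (M : Matrix W W ℚ) (u v : W)
    (huv : u ≠ v)
    (hM : ∀ x y, M x y = N (some (some x)) (some (some y))
      + (if x = u ∧ y = v then -1 else 0) + (if x = v ∧ y = u then -1 else 0))
    (h1 : N none none = 0) (h2 : N none (some none) = -1) (h3 : N (some none) none = -1)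
    (h4 : N (some none) (some none) = 0)
    (h5 : ∀ x, N none (some (some x)) = if x = v then -1 else 0)
    (h6 : ∀ x, N (some (some x)) none = if x = v then -1 else 0)
    (h7 : ∀ x, N (some none) (some (some x)) = if x = u then -1 else 0)
    (h8 : ∀ x, N (some (some x)) (some none) = if x = u then -1 else 0) :
    N.permanent = M.permanent := by
  set K : Matrix W W ℚ := fun x y => N (some (some x)) (some (some y)) with hK
  have hK' : ∀ x y, N (some (some x)) (some (some y)) = K x y := fun _ _ => rfl
  clear_value K
  set eu : W → ℚ := fun x => if x = u then -1 else 0 with heu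
  set ev : W → ℚ := fun x => if x = v then -1 else 0 with hev
  have hR : M.permanent = K.permanent + (K.updateRow u ev).permanent
      + (K.updateRow v eu).permanent + ((K.updateRow u ev).updateRow v eu).permanent := by
    have e1 : M = (K.updateRow u (K u + ev)).updateRow v (K v + eu) := by
      ext x y
      rw [hM]
      by_cases hxv : x = v
      · subst hxv
        simp [hK', heu, huv.symm]
      · by_cases hxu : x = u
        · subst hxu
          simp [hK', hev, huv, Matrix.updateRow_apply]
        · simp [hK', hxv, hxu, Matrix.updateRow_apply]
    have e2 : (K.updateRow u (K u + ev)).updateRow v (K v) = K.updateRow u (K u + ev) := by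
      ext x y
      by_cases hxv : x = v
      · subst hxv
        simp [huv.symm]
      · simp [hxv]
    have e3 : (K.updateRow u (K u + ev)).updateRow v eu
        = (K.updateRow v eu).updateRow u (K u + ev) := by
      rw [Matrix.updateRow_comm _ huv]
    have e4 : (K.updateRow v eu).updateRow u (K u) = K.updateRow v eu := by
      ext x y
      by_cases hxu : x = u
      · subst hxu
        simp [huv]
      · simp [hxu]
    rw [e1, perm_updateRow_add, e2, e3, perm_updateRow_add, perm_updateRow_add, e4,
      Matrix.updateRow_eq_self, Matrix.updateRow_comm _ huv]
    ring
  have hS : ((K.updateRow u ev).updateRow v eu).permanent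
      = ((K.updateRow u eu).updateRow v ev).permanent := by
    rw [← Matrix.permanent_permute_cols (Equiv.swap u v)]
    congr 1
    ext x y
    by_cases hxv : x = v
    · subst hxv
      simp [huv]
    · by_cases hxu : x = u
      · subst hxu
        simp [huv]
      · simp [Equiv.swap_apply_of_ne_of_ne, hxu, hxv]
  rw [hR, hS, perm_expand]
  rw [Fintype.sum_option, h1, h3]
  simp only [h6, ite_mul, zero_mul, Finset.sum_ite_eq', Finset.mem_univ, if_true, zero_add]
  rw [perm_expand, perm_expand, Fintype.sum_eq_single u, Finset.sum_eq_add u v huv]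
  · simp only [Matrix.submatrix_apply, Matrix.updateRow_apply, h2, h4, h8, h5, h7]
    have t1 : ((((N.submatrix some some).updateRow none fun y => N none (some y)).submatrix
        some some)) = K := by
      ext x y; simp [hK']
    have t2 : (((N.submatrix some some).updateRow (some v) fun y => N none (some y)).submatrix
        some some) = K.updateRow v ev := by
      ext x y
      by_cases h : x = v
      · subst h; simp [hev, h5]
      · simp [hK', h, Matrix.updateRow_apply]
    rw [t1, t2]
    simp [huv]
    simp only [← hev, ← heu]
    rw [Matrix.updateRow_comm _ huv]
    ring
  · intro x _ hx
    simp [Matrix.updateRow_apply, h8, hx.1, hx.2]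
  · simp
  · simp
  · intro x hx
    simp [Matrix.updateRow_apply, h8, hx]

/-- entry between a hub and an inner path vertex -/
def thHub (k : ℕ) (h : Bool) (x : Fin k) : ℚ :=
  if (if h then x.val + 1 = k else x.val = 0) then -1 else 0

/-- entry between two inner vertices of the same path -/
def thPath (k : ℕ) (x y : Fin k) : ℚ :=
  if x.val + 1 = y.val ∨ y.val + 1 = x.val then -1 else 0

/-- contribution of an empty path -/
def thZ (k : ℕ) : ℚ := if k = 0 then -1 else 0

/-- The vertex type -/
abbrev ThV (p q r : ℕ) := Bool ⊕ (Fin p ⊕ (Fin q ⊕ Fin r))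

/-- The matrix (multigraph version) -/
def thM (p q r : ℕ) : Matrix (ThV p q r) (ThV p q r) ℚ
  | .inl a, .inl b => if a = b then -1 else thZ p + thZ q + thZ r
  | .inl h, .inr (.inl x) => thHub p h x
  | .inl h, .inr (.inr (.inl x)) => thHub q h x
  | .inl h, .inr (.inr (.inr x)) => thHub r h x
  | .inr (.inl x), .inl h => thHub p h x
  | .inr (.inr (.inl x)), .inl h => thHub q h x
  | .inr (.inr (.inr x)), .inl h => thHub r h x
  | .inr (.inl x), .inr (.inl y) => thPath p x y
  | .inr (.inr (.inl x)), .inr (.inr (.inl y)) => thPath q x y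
  | .inr (.inr (.inr x)), .inr (.inr (.inr y)) => thPath r x y
  | .inr (.inl _), .inr (.inr _) => 0
  | .inr (.inr _), .inr (.inl _) => 0
  | .inr (.inr (.inl _)), .inr (.inr (.inr _)) => 0
  | .inr (.inr (.inr _)), .inr (.inr (.inl _)) => 0

lemma perm_reindex {V W : Type*} [Fintype V] [DecidableEq V] [Fintype W] [DecidableEq W]
    (e : V ≃ W) (M : Matrix W W ℚ) : (M.submatrix e e).permanent = M.permanent := by
  unfold Matrix.permanent
  refine Fintype.sum_equiv (Equiv.permCongr e) _ _ fun τ => ?_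
  refine Fintype.prod_equiv e _ _ fun x => ?_
  simp

lemma thM_swap12 (p q r : ℕ) : (thM p q r).permanent = (thM q p r).permanent := by
  let e : ThV p q r ≃ ThV q p r :=
    { toFun := fun x => match x with
        | .inl a => .inl a
        | .inr (.inl x) => .inr (.inr (.inl x))
        | .inr (.inr (.inl x)) => .inr (.inl x)
        | .inr (.inr (.inr x)) => .inr (.inr (.inr x))
      invFun := fun x => match x with
        | .inl a => .inl a
        | .inr (.inl x) => .inr (.inr (.inl x))
        | .inr (.inr (.inl x)) => .inr (.inl x)
        | .inr (.inr (.inr x)) => .inr (.inr (.inr x))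
      left_inv := by rintro (_ | _ | _ | _) <;> rfl
      right_inv := by rintro (_ | _ | _ | _) <;> rfl }
  rw [← perm_reindex e]
  congr 1
  ext x y
  rcases x with x | x | x | x <;> rcases y with y | y | y | y <;>
    simp [e, thM, add_comm]

lemma thM_swap23 (p q r : ℕ) : (thM p q r).permanent = (thM p r q).permanent := by
  let e : ThV p q r ≃ ThV p r q :=
    { toFun := fun x => match x with
        | .inl a => .inl a
        | .inr (.inl x) => .inr (.inl x)
        | .inr (.inr (.inl x)) => .inr (.inr (.inr x))
        | .inr (.inr (.inr x)) => .inr (.inr (.inl x))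
      invFun := fun x => match x with
        | .inl a => .inl a
        | .inr (.inl x) => .inr (.inl x)
        | .inr (.inr (.inl x)) => .inr (.inr (.inr x))
        | .inr (.inr (.inr x)) => .inr (.inr (.inl x))
      left_inv := by rintro (_ | _ | _ | _) <;> rfl
      right_inv := by rintro (_ | _ | _ | _) <;> rfl }
  rw [← perm_reindex e]
  congr 1
  ext x y
  rcases x with x | x | x | x <;> rcases y with y | y | y | y <;>
    simp [e, thM, add_assoc, add_comm (thZ q)]

/-- embedding used for the reduction -/
def thE (p q r : ℕ) : Option (Option (ThV p q r)) → ThV p q (r + 2)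
  | none => .inr (.inr (.inr ⟨r + 1, by omega⟩))
  | some none => .inr (.inr (.inr ⟨r, by omega⟩))
  | some (some (.inl a)) => .inl a
  | some (some (.inr (.inl x))) => .inr (.inl x)
  | some (some (.inr (.inr (.inl x)))) => .inr (.inr (.inl x))
  | some (some (.inr (.inr (.inr x)))) => .inr (.inr (.inr ⟨x.val, by omega⟩))

lemma thE_bij (p q r : ℕ) : Function.Bijective (thE p q r) := by
  rw [Fintype.bijective_iff_injective_and_card]
  constructor
  · rintro (_ | _ | x | x | x | x) (_ | _ | y | y | y | y) h <;>
      simp [thE, Fin.ext_iff] at h ⊢ <;> first | exact h | omega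
  · simp; omega

/-- the last vertex before the second hub -/
def thU (p q : ℕ) : (r : ℕ) → ThV p q r
  | 0 => .inl false
  | r + 1 => .inr (.inr (.inr ⟨r, by omega⟩))

lemma thM_step (p q r : ℕ) : (thM p q (r + 2)).permanent = (thM p q r).permanent := by
  rw [← perm_reindex (Equiv.ofBijective _ (thE_bij p q r))]
  refine perm_contract _ _ (thU p q r) (.inl true) ?_ ?_ ?_ ?_ ?_ ?_ ?_ ?_ ?_ ?_
  · cases r <;> simp [thU]
  · intro x y
    cases r <;> rcases x with (_ | _) | x | x | x <;> rcases y with (_ | _) | y | y | y <;>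
      simp only [thU, thE, thM, thZ, thHub, thPath, Matrix.submatrix_apply,
        Equiv.ofBijective_apply] <;> grind
  all_goals try intro x
  all_goals try rcases x with x | x | x | x
  all_goals cases r <;> simp only [thU, thE, thM, thHub, thPath, Matrix.submatrix_apply,
        Equiv.ofBijective_apply] <;> grind

lemma perm_fin_expand {n : ℕ} (N : Matrix (Fin (n + 1)) (Fin (n + 1)) ℚ) :
    N.permanent = N 0 0 * (Matrix.of fun x y : Fin n => N x.succ y.succ).permanent
      + ∑ w : Fin n, N w.succ 0 *
        (Matrix.of fun x y : Fin n => if x = w then N 0 y.succ else N x.succ y.succ).permanent := by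
  rw [← perm_reindex (finSuccEquiv n).symm, perm_expand]
  simp only [Matrix.submatrix_apply, finSuccEquiv_symm_none, finSuccEquiv_symm_some]
  congr 1
  refine Finset.sum_congr rfl fun w _ => ?_
  congr 2
  ext x y
  simp [Matrix.updateRow_apply]

/-- Labelling of the vertices of the small cases, inner vertices first. -/
def thS (p q r : ℕ) : ThV p q r → Fin (p + q + r + 2)
  | .inl false => ⟨p + q + r, by omega⟩
  | .inl true => ⟨p + q + r + 1, by omega⟩
  | .inr (.inl x) => ⟨x.val, by omega⟩
  | .inr (.inr (.inl x)) => ⟨p + x.val, by omega⟩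
  | .inr (.inr (.inr x)) => ⟨p + q + x.val, by omega⟩

lemma thS_bij (p q r : ℕ) : Function.Bijective (thS p q r) := by
  rw [Fintype.bijective_iff_injective_and_card]
  constructor
  · rintro ((_ | _) | x | x | x) ((_ | _) | y | y | y) h <;>
      simp [thS, Fin.ext_iff] at h ⊢ <;> omega
  · simp; omega

lemma thM_of_fin (p q r : ℕ) (N : Matrix (Fin (p + q + r + 2)) (Fin (p + q + r + 2)) ℚ)
    (h : ∀ x y, thM p q r x y = N (thS p q r x) (thS p q r y)) :
    (thM p q r).permanent = N.permanent := by
  rw [← perm_reindex (Equiv.ofBijective _ (thS_bij p q r)) N]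
  congr 1
  ext x y
  exact h x y

lemma thM_000 : (thM 0 0 0).permanent = 10 := by
  rw [thM_of_fin 0 0 0 !![-1, -3; -3, -1]]
  · simp [perm_fin_expand, Fin.sum_univ_succ]
    norm_num
  · rintro ((_ | _) | x | x | x) ((_ | _) | y | y | y) <;>
      first | exact x.elim0 | exact y.elim0 | skip
    all_goals try (obtain rfl : x = 0 := Subsingleton.elim _ _)
    all_goals try (obtain rfl : y = 0 := Subsingleton.elim _ _)
    all_goals norm_num [thM, thS, thZ, thHub, thPath]

lemma thM_001 : (thM 0 0 1).permanent = -6 := by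
  rw [thM_of_fin 0 0 1 !![0, -1, -1; -1, -1, -2; -1, -2, -1]]
  · simp [perm_fin_expand, Fin.sum_univ_succ]
    norm_num
  · rintro ((_ | _) | x | x | x) ((_ | _) | y | y | y) <;>
      first | exact x.elim0 | exact y.elim0 | skip
    all_goals try (obtain rfl : x = 0 := Subsingleton.elim _ _)
    all_goals try (obtain rfl : y = 0 := Subsingleton.elim _ _)
    all_goals norm_num [thM, thS, thZ, thHub, thPath]

lemma thM_011 : (thM 0 1 1).permanent = 4 := by
  rw [thM_of_fin 0 1 1 !![0, 0, -1, -1; 0, 0, -1, -1; -1, -1, -1, -1; -1, -1, -1, -1]]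
  · simp [perm_fin_expand, Fin.sum_univ_succ]
    norm_num
  · rintro ((_ | _) | x | x | x) ((_ | _) | y | y | y) <;>
      first | exact x.elim0 | exact y.elim0 | skip
    all_goals try (obtain rfl : x = 0 := Subsingleton.elim _ _)
    all_goals try (obtain rfl : y = 0 := Subsingleton.elim _ _)
    all_goals norm_num [thM, thS, thZ, thHub, thPath]

lemma thM_111 : (thM 1 1 1).permanent = 0 := by
  rw [thM_of_fin 1 1 1 !![0, 0, 0, -1, -1; 0, 0, 0, -1, -1; 0, 0, 0, -1, -1;
    -1, -1, -1, -1, 0; -1, -1, -1, 0, -1]]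
  · simp [perm_fin_expand, Fin.sum_univ_succ]
  · rintro ((_ | _) | x | x | x) ((_ | _) | y | y | y) <;>
      first | exact x.elim0 | exact y.elim0 | skip
    all_goals try (obtain rfl : x = 0 := Subsingleton.elim _ _)
    all_goals try (obtain rfl : y = 0 := Subsingleton.elim _ _)
    all_goals norm_num [thM, thS, thZ, thHub, thPath]

lemma thM_base : ∀ p q r : Fin 2, (thM p q r).permanent =
      1/2 + (3/2) * (-1 : ℚ) ^ (p.val + r.val) + (3/2) * (-1 : ℚ) ^ (p.val + q.val)
        + (3/2) * (-1 : ℚ) ^ (r.val + q.val) + 5 * (-1 : ℚ) ^ (p.val + q.val + r.val) := by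
  have h010 : (thM 0 1 0).permanent = -6 := by rw [thM_swap23, thM_001]
  have h100 : (thM 1 0 0).permanent = -6 := by rw [thM_swap12, h010]
  have h101 : (thM 1 0 1).permanent = 4 := by rw [thM_swap12, thM_011]
  have h110 : (thM 1 1 0).permanent = 4 := by rw [thM_swap23, h101]
  intro p q r
  fin_cases p <;> fin_cases q <;> fin_cases r
  · exact thM_000.trans (by norm_num)
  · exact thM_001.trans (by norm_num)
  · exact h010.trans (by norm_num)
  · exact thM_011.trans (by norm_num)
  · exact h100.trans (by norm_num)
  · exact h101.trans (by norm_num)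
  · exact h110.trans (by norm_num)
  · exact thM_111.trans (by norm_num)

lemma thM_parity (p q r : ℕ) : (thM p q r).permanent =
      1/2 + (3/2) * (-1 : ℚ) ^ (p + r) + (3/2) * (-1 : ℚ) ^ (p + q)
        + (3/2) * (-1 : ℚ) ^ (r + q) + 5 * (-1 : ℚ) ^ (p + q + r) := by
  have step : ∀ p q r, (thM p q r).permanent = (thM p q (r % 2)).permanent := by
    intro p q r
    induction r using Nat.strong_induction_on with
    | _ r ih =>
      by_cases h : r < 2
      · rw [Nat.mod_eq_of_lt h]
      · obtain ⟨s, rfl⟩ : ∃ s, r = s + 2 := ⟨r - 2, by omega⟩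
        rw [thM_step, ih s (by omega), Nat.add_mod_right]
  have hb := thM_base ⟨p % 2, by omega⟩ ⟨q % 2, by omega⟩ ⟨r % 2, by omega⟩
  rw [step, thM_swap23, step, thM_swap12, thM_swap23, step, thM_swap12, thM_swap23,
    thM_swap12, thM_swap23, thM_swap12]
  have hp : ∀ k : ℕ, (-1 : ℚ) ^ k = (-1) ^ (k % 2) := fun k => neg_one_pow_eq_pow_mod_two k
  simp only [pow_add] at hb ⊢
  rw [hp p, hp q, hp r]
  rw [thM_swap12, thM_swap23]
  exact hb

/-- Labelling of the vertices. -/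
def thL (p q r : ℕ) : ThV p q r → Fin (p + q + r + 2)
  | .inl false => ⟨0, by omega⟩
  | .inl true => ⟨1, by omega⟩
  | .inr (.inl x) => ⟨2 + x.val, by omega⟩
  | .inr (.inr (.inl x)) => ⟨p + 2 + x.val, by omega⟩
  | .inr (.inr (.inr x)) => ⟨p + q + 2 + x.val, by omega⟩

lemma thL_bij (p q r : ℕ) : Function.Bijective (thL p q r) := by
  rw [Fintype.bijective_iff_injective_and_card]
  constructor
  · rintro ((_ | _) | x | x | x) ((_ | _) | y | y | y) h <;>
      simp [thL, Fin.ext_iff] at h ⊢ <;> omega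
  · simp; omega

lemma thM_adj (p q r : ℕ) (h0 : (0 < p ∧ 0 < q) ∨ (0 < p ∧ 0 < r) ∨ (0 < q ∧ 0 < r))
    (x y : ThV p q r) (hxy : x ≠ y) :
    (if (thetaGraph p q r).Adj (thL p q r x) (thL p q r y) then (1 : ℚ) else 0)
      = - thM p q r x y := by
  rw [thetaGraph, SimpleGraph.fromRel_adj]
  rcases x with (_ | _) | x | x | x <;> rcases y with (_ | _) | y | y | y <;>
    simp only [thL, thM, thZ, thHub, thPath, ne_eq, Fin.ext_iff] <;> grind

lemma sum_thPath (k : ℕ) (x : Fin k) :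
    ∑ y, thPath k x y = -2 - thHub k false x - thHub k true x := by
  have h : ∀ y : Fin k, thPath k x y =
      (if x.val + 1 = y.val then -1 else 0) + (if y.val + 1 = x.val then -1 else 0) := by
    intro y; unfold thPath; grind
  simp_rw [h]
  rw [Finset.sum_add_distrib]
  have h1 : ∑ y : Fin k, (if x.val + 1 = y.val then (-1 : ℚ) else 0)
      = if x.val + 1 = k then 0 else -1 := by
    split_ifs with hk
    · exact Finset.sum_eq_zero fun y _ => if_neg (by omega)
    · rw [Fintype.sum_eq_single ⟨x.val + 1, by omega⟩]
      · simp
      · intro y hy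
        exact if_neg fun h => hy (Fin.ext h.symm)
  have h2 : ∑ y : Fin k, (if y.val + 1 = x.val then (-1 : ℚ) else 0)
      = if x.val = 0 then 0 else -1 := by
    split_ifs with hk
    · exact Finset.sum_eq_zero fun y _ => if_neg (by omega)
    · rw [Fintype.sum_eq_single ⟨x.val - 1, by omega⟩]
      · exact if_pos (by simp; omega)
      · intro y hy
        exact if_neg fun h => hy (Fin.ext (by simp; omega))
  rw [h1, h2]
  unfold thHub
  grind

lemma sum_thHub (k : ℕ) (h : Bool) : ∑ x, thHub k h x = -1 - thZ k := by
  rcases Nat.eq_zero_or_pos k with rfl | hk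
  · simp [thZ]
  · cases h
    · rw [Fintype.sum_eq_single ⟨0, hk⟩]
      · simp [thHub, thZ, hk.ne']
      · intro y hy
        exact if_neg fun h => hy (Fin.ext (by simpa using h))
    · rw [Fintype.sum_eq_single ⟨k - 1, by omega⟩]
      · have : k - 1 + 1 = k := by omega
        simp [thHub, thZ, hk.ne', this]
      · intro y hy
        exact if_neg fun h => hy (Fin.ext (by simp at h ⊢; omega))

lemma thM_rowsum (p q r : ℕ) (x : ThV p q r) :
    ∑ y, thM p q r x y = 2 * thM p q r x x - 2 := by
  simp only [Fintype.sum_sum_type, Fintype.sum_bool]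
  rcases x with (_ | _) | x | x | x <;>
    simp [thM, sum_thPath, sum_thHub] <;> (try simp [thPath]) <;> ring

/-- **Lemma 4.3.** The value of the signless Laplacian permanental polynomial of
`θ(p,q,r)` at `x = 2`. -/
theorem qPermAtTwo_thetaGraph
    (p q r : ℕ) (h0 : (0 < p ∧ 0 < q) ∨ (0 < p ∧ 0 < r) ∨ (0 < q ∧ 0 < r)) :
    qPermAtTwo (thetaGraph p q r) =
      1/2 + (3/2) * (-1 : ℚ) ^ (p + r) + (3/2) * (-1 : ℚ) ^ (p + q)
        + (3/2) * (-1 : ℚ) ^ (r + q) + 5 * (-1 : ℚ) ^ (p + q + r) := by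
  rw [← thM_parity]
  let e := Equiv.ofBijective _ (thL_bij p q r)
  have hr : qPermAtTwo (thetaGraph p q r) =
      ((Matrix.diagonal (fun _ => (2 : ℚ)) - signlessLapMatrix (thetaGraph p q r)).submatrix
        e e).permanent := by
    rw [perm_reindex]
    unfold qPermAtTwo
    congr!
  rw [hr]
  congr 1
  ext x y
  by_cases hxy : x = y
  · subst hxy
    have hdeg : ((thetaGraph p q r).degree (e x) : ℚ) = thM p q r x x - (2 * thM p q r x x - 2) := by
      rw [← thM_rowsum, SimpleGraph.degree, SimpleGraph.neighborFinset_eq_filter,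
        Finset.card_filter, Nat.cast_sum, ← Equiv.sum_comp e,
        ← Finset.add_sum_erase _ _ (Finset.mem_univ x),
        ← Finset.add_sum_erase _ _ (Finset.mem_univ x)]
      have : ∀ y ∈ Finset.univ.erase x,
          (((if (thetaGraph p q r).Adj (e x) (e y) then 1 else 0 : ℕ)) : ℚ) = - thM p q r x y := by
        intro y hy
        rw [← thM_adj p q r h0 x y (Finset.ne_of_mem_erase hy).symm]
        push_cast
        rfl
      rw [Finset.sum_congr rfl this]
      simp
    simp [signlessLapMatrix, SimpleGraph.degMatrix]
    rw [hdeg]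
    ring
  · have := thM_adj p q r h0 x y hxy
    have hne : e x ≠ e y := fun h => hxy (e.injective h)
    simp only [signlessLapMatrix, SimpleGraph.degMatrix, Matrix.submatrix_apply, Matrix.sub_apply,
      Matrix.add_apply, SimpleGraph.adjMatrix_apply, Matrix.diagonal_apply_ne _ hne]
    rw [← neg_neg (thM p q r x y), ← this]
    simp [e]
    exact @Matrix.diagonal_apply_ne _ _ (_) _ _ _ _ hne
end
end
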